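/- arXiv:1901.01894 — 16 statements merged into one kernel-verified Lean document; each statement's English description precedes it below -/
import Mathlib

section
/- Let a1 ≥ a2 > 0 be real channel coefficients and R_min > 0. Suppose 2^{R_min} > a1/a2. Define R1* = R_min/2 + (1/2)·log2(a1/a2) and R2* = R_min − R1*. Then 0 < R2* ≤ R1* < R_min, and for every pair (R1, R2) of nonnegative reals with R1 + R2 = R_min, one has (2^{R1*} − 1)/a1 + (2^{R2*} − 1)/a2 ≤ (2^{R1} − 1)/a1 + (2^{R2} − 1)/a2; that is, (R1*, R2*) minimizes the total transmit power over the two links. -/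
/-- Two-link power minimization (Lemma 1, optimality part): if `2^Rmin > a1/a2`,
the rate split `R1* = Rmin/2 + (1/2)·log2(a1/a2)`, `R2* = Rmin − R1*` is feasible
(`0 < R2* ≤ R1* < Rmin`) and minimizes the total transmit power among all
nonnegative rate pairs summing to `Rmin`. -/
theorem two_link_optimal_split
    (a1 a2 Rmin : ℝ) (ha2 : 0 < a2) (ha : a2 ≤ a1) (hRmin : 0 < Rmin)
    (hcond : a1 / a2 < (2 : ℝ) ^ Rmin)
    (R1star R2star : ℝ)
    (hR1 : R1star = Rmin / 2 + (1 / 2) * Real.logb 2 (a1 / a2))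
    (hR2 : R2star = Rmin - R1star) :
    (0 < R2star ∧ R2star ≤ R1star ∧ R1star < Rmin) ∧
    ∀ R1 R2 : ℝ, 0 ≤ R1 → 0 ≤ R2 → R1 + R2 = Rmin →
      ((2 : ℝ) ^ R1star - 1) / a1 + ((2 : ℝ) ^ R2star - 1) / a2 ≤
        ((2 : ℝ) ^ R1 - 1) / a1 + ((2 : ℝ) ^ R2 - 1) / a2 := by
  have ha1 : 0 < a1 := lt_of_lt_of_le ha2 ha
  have hq : 0 < a1 / a2 := div_pos ha1 ha2
  have hL0 : 0 ≤ Real.logb 2 (a1 / a2) :=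
    Real.logb_nonneg (by norm_num) ((one_le_div ha2).2 ha)
  have hL1 : Real.logb 2 (a1 / a2) < Rmin :=
    (Real.logb_lt_iff_lt_rpow (by norm_num) hq).2 hcond
  refine ⟨⟨by linarith, by linarith, by linarith⟩, ?_⟩
  intro R1 R2 _ _ hsum
  have hx : (2 : ℝ) ^ R1star = (2 : ℝ) ^ R2star * (a1 / a2) := by
    have h : R1star = R2star + Real.logb 2 (a1 / a2) := by linarith
    rw [h, Real.rpow_add (by norm_num), Real.rpow_logb (by norm_num) (by norm_num) hq]
  have hprod : (2 : ℝ) ^ R1 * (2 : ℝ) ^ R2 = (2 : ℝ) ^ R1star * (2 : ℝ) ^ R2star := by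
    rw [← Real.rpow_add (by norm_num), ← Real.rpow_add (by norm_num)]
    congr 1
    linarith
  have hu : 0 < (2 : ℝ) ^ R1 := by positivity
  have hv : 0 < (2 : ℝ) ^ R2 := by positivity
  have hy : 0 < (2 : ℝ) ^ R2star := by positivity
  rw [hx] at hprod ⊢
  generalize (2 : ℝ) ^ R1 = u at *
  generalize (2 : ℝ) ^ R2 = v at *
  generalize (2 : ℝ) ^ R2star = y at *
  have hX : y * (a1 / a2) / a1 = y / a2 := by field_simp
  have hUV : (u / a1) * (v / a2) = (y / a2) ^ 2 := by
    rw [div_mul_div_comm, hprod]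
    field_simp
  have hU : 0 < u / a1 := div_pos hu ha1
  have hV : 0 < v / a2 := div_pos hv ha2
  have key : 2 * (y / a2) ≤ u / a1 + v / a2 := by
    exact abs_le_of_sq_le_sq' (by nlinarith [sq_nonneg (u / a1 - v / a2)]) (by linarith) |>.2
  simp only [sub_div]
  rw [hX]
  linarith
end

section
/- Let a1 ≥ a2 > 0 and R_min > 0 with 2^{R_min} > a1/a2. Let R1* = R_min/2 + (1/2)·log2(a1/a2) and R2* = R_min − R1*. Then the minimal two-link power satisfies (2^{R1*} − 1)/a1 + (2^{R2*} − 1)/a2 = 2^{R_min/2 + 1}/√(a1·a2) − (1/a1 + 1/a2), and this quantity is strictly less than (2^{R_min} − 1)/a1. -/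
/-- Two-link power minimization (Lemma 1, value part): if `2^Rmin > a1/a2`,
the minimal two-link power equals `2^(Rmin/2+1)/√(a1·a2) − (1/a1 + 1/a2)`,
which is strictly smaller than the single-link power `(2^Rmin − 1)/a1`. -/
theorem two_link_min_power_value
    (a1 a2 Rmin : ℝ) (ha2 : 0 < a2) (ha : a2 ≤ a1) (hRmin : 0 < Rmin)
    (hcond : a1 / a2 < (2 : ℝ) ^ Rmin)
    (R1star R2star : ℝ)
    (hR1 : R1star = Rmin / 2 + (1 / 2) * Real.logb 2 (a1 / a2))
    (hR2 : R2star = Rmin - R1star) :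
    ((2 : ℝ) ^ R1star - 1) / a1 + ((2 : ℝ) ^ R2star - 1) / a2 =
      (2 : ℝ) ^ (Rmin / 2 + 1) / Real.sqrt (a1 * a2) - (1 / a1 + 1 / a2) ∧
    (2 : ℝ) ^ (Rmin / 2 + 1) / Real.sqrt (a1 * a2) - (1 / a1 + 1 / a2) <
      ((2 : ℝ) ^ Rmin - 1) / a1 := by
  obtain ⟨t, ht, rfl⟩ : ∃ t : ℝ, 0 < t ∧ a2 = t ^ 2 :=
    ⟨Real.sqrt a2, Real.sqrt_pos.2 ha2, (Real.sq_sqrt ha2.le).symm⟩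
  have ha1 : 0 < a1 := lt_of_lt_of_le ha2 ha
  obtain ⟨s, hs, rfl⟩ : ∃ s : ℝ, 0 < s ∧ a1 = s ^ 2 :=
    ⟨Real.sqrt a1, Real.sqrt_pos.2 ha1, (Real.sq_sqrt ha1.le).symm⟩
  have hsq : Real.sqrt (s ^ 2 * t ^ 2) = s * t := by
    rw [← mul_pow, Real.sqrt_sq (by positivity)]
  have hst : 0 < s / t := by positivity
  have hlog : (1 / 2) * Real.logb 2 (s ^ 2 / t ^ 2) = Real.logb 2 (s / t) := by
    rw [← div_pow, Real.logb_pow]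
    push_cast
    ring
  have hl : (2 : ℝ) ^ Real.logb 2 (s / t) = s / t :=
    Real.rpow_logb (by norm_num) (by norm_num) hst
  have h2 : (0 : ℝ) < 2 := by norm_num
  have hR2' : R2star = Rmin / 2 - Real.logb 2 (s / t) := by
    rw [hR2, hR1, hlog]; ring
  have hx2 : (2 : ℝ) ^ Rmin = ((2 : ℝ) ^ (Rmin / 2)) ^ 2 := by
    rw [pow_two, ← Real.rpow_add h2]; congr 1; ring
  rw [hlog] at hR1
  rw [hR2', hR1, hsq, Real.rpow_add h2, Real.rpow_sub h2, Real.rpow_add h2, hl, Real.rpow_one, hx2]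
  rw [hx2] at hcond
  have hx : 0 < (2 : ℝ) ^ (Rmin / 2) := Real.rpow_pos_of_pos h2 _
  generalize (2 : ℝ) ^ (Rmin / 2) = x at *
  constructor
  · field_simp
    ring
  · have h1 : s / t < x := by
      rw [← div_pow] at hcond
      exact lt_of_pow_lt_pow_left₀ 2 hx.le hcond
    have h3 : 0 < x / s - 1 / t := by
      rw [div_lt_iff₀ ht] at h1
      rw [sub_pos, div_lt_div_iff₀ ht hs]
      linarith
    have h4 : (x ^ 2 - 1) / s ^ 2 - (x * 2 / (s * t) - (1 / s ^ 2 + 1 / t ^ 2))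
        = (x / s - 1 / t) ^ 2 := by
      field_simp
      ring
    have h5 := pow_pos h3 2
    linarith
end

section
/- Let a1 ≥ a2 > 0 and R_min > 0 with 2^{R_min} ≤ a1/a2. Then for every pair (R1, R2) of nonnegative reals with R1 + R2 = R_min, one has (2^{R1} − 1)/a1 + (2^{R2} − 1)/a2 ≥ (2^{R_min} − 1)/a1; that is, splitting the transmission over the two links can never use less power than transmitting everything over the best channel. -/
/-- Two-link power minimization (Lemma 1, single-link case): if `2^Rmin ≤ a1/a2`,
no nonnegative rate split `R1 + R2 = Rmin` over the two links uses less power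
than transmitting everything over the best channel. -/
theorem two_link_single_channel_optimal
    (a1 a2 Rmin : ℝ) (ha2 : 0 < a2) (ha : a2 ≤ a1) (hRmin : 0 < Rmin)
    (hcond : (2 : ℝ) ^ Rmin ≤ a1 / a2) :
    ∀ R1 R2 : ℝ, 0 ≤ R1 → 0 ≤ R2 → R1 + R2 = Rmin →
      ((2 : ℝ) ^ Rmin - 1) / a1 ≤
        ((2 : ℝ) ^ R1 - 1) / a1 + ((2 : ℝ) ^ R2 - 1) / a2 := by
  intro R1 R2 h1 h2 hs
  have ha1 : 0 < a1 := lt_of_lt_of_le ha2 ha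
  rw [← hs, Real.rpow_add (by norm_num)] at hcond ⊢
  have hx : (1 : ℝ) ≤ (2 : ℝ) ^ R1 := Real.one_le_rpow (by norm_num) h1
  have hy : (1 : ℝ) ≤ (2 : ℝ) ^ R2 := Real.one_le_rpow (by norm_num) h2
  generalize (2 : ℝ) ^ R1 = x at *
  generalize (2 : ℝ) ^ R2 = y at *
  rw [le_div_iff₀ ha2] at hcond
  have hxa : x * a2 ≤ a1 := by
    have : x * 1 * a2 ≤ x * y * a2 := by gcongr
    linarith
  have key : (x * (y - 1)) / a1 ≤ (y - 1) / a2 := by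
    rw [div_le_div_iff₀ ha1 ha2]
    nlinarith [mul_le_mul_of_nonneg_left hxa (sub_nonneg.2 hy)]
  have e : (x * y - 1) / a1 = (x - 1) / a1 + (x * (y - 1)) / a1 := by ring
  linarith
end

section
/- Let a1 ≥ a2 > 0, R_min > 0, and let R1 be a real number with 0 ≤ R1 < R_min; set R2 = R_min − R1. Then (2^{R1} − 1)/a1 + (2^{R2} − 1)/a2 < (2^{R_min} − 1)/a1 if and only if 2^{R1} > a1/a2. -/
/-- Equation (16): for `0 ≤ R1 < Rmin` and `R2 = Rmin − R1`, the double-link power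
is strictly smaller than the single-link power iff `2^R1 > a1/a2`. -/
theorem two_link_improvement_iff
    (a1 a2 Rmin R1 R2 : ℝ) (ha2 : 0 < a2) (ha : a2 ≤ a1) (hRmin : 0 < Rmin)
    (hR1 : 0 ≤ R1) (hR1' : R1 < Rmin) (hR2 : R2 = Rmin - R1) :
    ((2 : ℝ) ^ R1 - 1) / a1 + ((2 : ℝ) ^ R2 - 1) / a2 < ((2 : ℝ) ^ Rmin - 1) / a1 ↔
      a1 / a2 < (2 : ℝ) ^ R1 := by
  have ha1 : 0 < a1 := lt_of_lt_of_le ha2 ha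
  have hy : 1 < (2 : ℝ) ^ R2 := Real.one_lt_rpow (by norm_num) (by linarith)
  have hxy : (2 : ℝ) ^ Rmin = (2 : ℝ) ^ R1 * (2 : ℝ) ^ R2 := by
    rw [← Real.rpow_add (by norm_num)]
    congr 1
    linarith
  rw [hxy]
  generalize (2 : ℝ) ^ R1 = x at *
  generalize (2 : ℝ) ^ R2 = y at *
  have hk : 0 < (y - 1) / a1 := div_pos (by linarith) ha1
  have key : (x * y - 1) / a1 - ((x - 1) / a1 + (y - 1) / a2)
      = (y - 1) / a1 * (x - a1 / a2) := by
    field_simp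
    ring
  rw [← sub_pos, key, mul_pos_iff_of_pos_left hk, sub_pos]
end

section
/- Let N ≥ 2, let a1 ≥ a2 ≥ … ≥ aN > 0 be real channel coefficients, and let R_min > 0 satisfy 2^{R_min} > (a1·a2·…·a_{N−1}) / a_N^{N−1}. Define R_i* = (1/N)·(R_min + log2(a_i^{N−1} / ∏_{j≠i} a_j)) for i = 1, …, N. Then every R_i* is strictly positive, ∑_{i=1}^N R_i* = R_min, and for every vector (R_1, …, R_N) of nonnegative reals with ∑_{i=1}^N R_i = R_min one has ∑_{i=1}^N (2^{R_i*} − 1)/a_i ≤ ∑_{i=1}^N (2^{R_i} − 1)/a_i. -/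
/-- Theorem 1 (optimality part): with `N ≥ 2` channels `a 1 ≥ a 2 ≥ ⋯ ≥ a N > 0`
and `2^Rmin > (∏_{i<N} a i)/(a N)^(N−1)`, the rates
`R i* = (1/N)·(Rmin + log2(a i^(N−1)/∏_{j≠i} a j))` are all strictly positive,
sum to `Rmin`, and minimize the total transmit power among all nonnegative rate
vectors summing to `Rmin`. -/
theorem N_link_optimal_rates
    (N : ℕ) (hN : 2 ≤ N) (a : ℕ → ℝ)
    (hpos : ∀ i ∈ Finset.Icc 1 N, 0 < a i)
    (hmono : ∀ i j : ℕ, 1 ≤ i → i ≤ j → j ≤ N → a j ≤ a i)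
    (Rmin : ℝ) (hRmin : 0 < Rmin)
    (hcond : (∏ i ∈ Finset.Icc 1 (N - 1), a i) / (a N) ^ (N - 1) < (2 : ℝ) ^ Rmin)
    (Rstar : ℕ → ℝ)
    (hRstar : ∀ i ∈ Finset.Icc 1 N,
      Rstar i = (1 / (N : ℝ)) *
        (Rmin + Real.logb 2 ((a i) ^ (N - 1) / ∏ j ∈ (Finset.Icc 1 N).erase i, a j))) :
    (∀ i ∈ Finset.Icc 1 N, 0 < Rstar i) ∧
    (∑ i ∈ Finset.Icc 1 N, Rstar i = Rmin) ∧
    ∀ R : ℕ → ℝ, (∀ i ∈ Finset.Icc 1 N, 0 ≤ R i) →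
      (∑ i ∈ Finset.Icc 1 N, R i = Rmin) →
      ∑ i ∈ Finset.Icc 1 N, ((2 : ℝ) ^ (Rstar i) - 1) / a i ≤
        ∑ i ∈ Finset.Icc 1 N, ((2 : ℝ) ^ (R i) - 1) / a i := by
  have hN0 : (0 : ℝ) < N := by positivity
  have hNN : N ∈ Finset.Icc 1 N := Finset.mem_Icc.2 ⟨by omega, le_rfl⟩
  have hcast : ((N - 1 : ℕ) : ℝ) = N - 1 := by
    rw [Nat.cast_sub (by omega)]; simp
  obtain ⟨S, hS⟩ : ∃ S, S = ∑ j ∈ Finset.Icc 1 N, Real.logb 2 (a j) := ⟨_, rfl⟩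
  have hlog : ∀ i ∈ Finset.Icc 1 N,
      Real.logb 2 ((a i) ^ (N - 1) / ∏ j ∈ (Finset.Icc 1 N).erase i, a j)
        = N * Real.logb 2 (a i) - S := by
    intro i hi
    have hp : ∀ j ∈ (Finset.Icc 1 N).erase i, a j ≠ 0 := fun j hj =>
      (hpos j (Finset.mem_of_mem_erase hj)).ne'
    rw [Real.logb_div (pow_ne_zero _ (hpos i hi).ne') (Finset.prod_ne_zero_iff.2 hp),
      Real.logb_pow, Real.logb_prod _ _ hp, hcast, hS, ← Finset.add_sum_erase _ _ hi]
    ring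
  have hR : ∀ i ∈ Finset.Icc 1 N, Rstar i = Real.logb 2 (a i) + (Rmin - S) / N := by
    intro i hi
    rw [hRstar i hi, hlog i hi]
    field_simp
    ring
  have herase : (Finset.Icc 1 N).erase N = Finset.Icc 1 (N - 1) := by
    ext x
    simp only [Finset.mem_erase, Finset.mem_Icc]
    omega
  have hc : S - N * Real.logb 2 (a N) < Rmin := by
    have h1 := hlog N hNN
    rw [herase] at h1
    have hP : 0 < ∏ i ∈ Finset.Icc 1 (N - 1), a i := by
      rw [← herase]
      exact Finset.prod_pos fun j hj => hpos j (Finset.mem_of_mem_erase hj)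
    have h2 := Real.logb_lt_logb (b := 2) (by norm_num)
      (div_pos hP (pow_pos (hpos N hNN) (N - 1))) hcond
    rw [Real.logb_rpow (by norm_num) (by norm_num), ← inv_div, Real.logb_inv, h1] at h2
    linarith
  have hsum : ∑ i ∈ Finset.Icc 1 N, Rstar i = Rmin := by
    rw [Finset.sum_congr rfl hR, Finset.sum_add_distrib, ← hS]
    simp only [Finset.sum_const, Nat.card_Icc, Nat.add_sub_cancel, nsmul_eq_mul]
    field_simp
    ring
  refine ⟨?_, hsum, ?_⟩
  · intro i hi
    have hle : Real.logb 2 (a N) ≤ Real.logb 2 (a i) :=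
      Real.logb_le_logb_of_le (by norm_num) (hpos N hNN)
        (hmono i N (Finset.mem_Icc.1 hi).1 (Finset.mem_Icc.1 hi).2 le_rfl)
    have h3 : 0 < Real.logb 2 (a N) + (Rmin - S) / N := by
      have : Real.logb 2 (a N) + (Rmin - S) / N
          = (Rmin - (S - N * Real.logb 2 (a N))) / N := by
        field_simp
        ring
      rw [this]
      exact div_pos (by linarith) hN0
    rw [hR i hi]
    linarith
  · intro R _ hRs
    have key : ∀ i ∈ Finset.Icc 1 N,
        ((2 : ℝ) ^ (Rstar i) - 1) / a i
          + (2 : ℝ) ^ ((Rmin - S) / N) * Real.log 2 * (R i - Rstar i)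
          ≤ ((2 : ℝ) ^ (R i) - 1) / a i := by
      intro i hi
      have ha := hpos i hi
      have e1 : (2 : ℝ) ^ (Rstar i) = a i * (2 : ℝ) ^ ((Rmin - S) / N) := by
        rw [hR i hi, Real.rpow_add (by norm_num),
          Real.rpow_logb (by norm_num) (by norm_num) ha]
      have e2 : (2 : ℝ) ^ (R i) = (2 : ℝ) ^ (Rstar i) * (2 : ℝ) ^ (R i - Rstar i) := by
        rw [← Real.rpow_add (by norm_num)]
        congr 1
        ring
      have e3 : Real.log 2 * (R i - Rstar i) + 1 ≤ (2 : ℝ) ^ (R i - Rstar i) := by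
        rw [Real.rpow_def_of_pos (by norm_num)]
        exact Real.add_one_le_exp _
      have h0 : 0 ≤ (2 : ℝ) ^ (Rstar i) := by positivity
      have e4 := mul_le_mul_of_nonneg_left e3 h0
      rw [← e2] at e4
      rw [le_div_iff₀ ha, add_mul, div_mul_cancel₀ _ ha.ne']
      rw [e1] at e4 ⊢
      linarith
    have h := Finset.sum_le_sum key
    rw [Finset.sum_add_distrib, ← Finset.mul_sum, Finset.sum_sub_distrib, hRs, hsum] at h
    simpa using h
end

section
/- Let N ≥ 1, let a1, …, aN > 0 be real numbers, and let R_min be real. Define R_i = (1/N)·(R_min + log2(a_i^{N−1} / ∏_{j≠i} a_j)) for i = 1, …, N. Then ∑_{i=1}^N R_i = R_min and ∑_{i=1}^N (2^{R_i} − 1)/a_i = N·(2^{R_min} / ∏_{i=1}^N a_i)^{1/N} − ∑_{i=1}^N 1/a_i. -/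
/-- Theorem 1 (closed-form power, equations (18) and (20)): for the rates
`R i = (1/N)·(Rmin + log2(a i^(N−1)/∏_{j≠i} a j))`, the rates sum to `Rmin`
and the total power equals `N·(2^Rmin/∏ a i)^(1/N) − ∑ 1/a i`. -/
theorem N_link_power_closed_form
    (N : ℕ) (hN : 1 ≤ N) (a : ℕ → ℝ)
    (hpos : ∀ i ∈ Finset.Icc 1 N, 0 < a i)
    (Rmin : ℝ)
    (R : ℕ → ℝ)
    (hR : ∀ i ∈ Finset.Icc 1 N,
      R i = (1 / (N : ℝ)) *
        (Rmin + Real.logb 2 ((a i) ^ (N - 1) / ∏ j ∈ (Finset.Icc 1 N).erase i, a j))) :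
    (∑ i ∈ Finset.Icc 1 N, R i = Rmin) ∧
    ∑ i ∈ Finset.Icc 1 N, ((2 : ℝ) ^ (R i) - 1) / a i =
      (N : ℝ) * ((2 : ℝ) ^ Rmin / ∏ i ∈ Finset.Icc 1 N, a i) ^ ((1 : ℝ) / (N : ℝ)) -
        ∑ i ∈ Finset.Icc 1 N, 1 / a i := by
  have hN0 : (N : ℝ) ≠ 0 := by
    have : N ≠ 0 := by omega
    exact_mod_cast this
  have hP : 0 < ∏ i ∈ Finset.Icc 1 N, a i := Finset.prod_pos hpos
  have hlogP : Real.logb 2 (∏ i ∈ Finset.Icc 1 N, a i)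
      = ∑ i ∈ Finset.Icc 1 N, Real.logb 2 (a i) :=
    Real.logb_prod _ _ (fun i hi => (hpos i hi).ne')
  have key : ∀ i ∈ Finset.Icc 1 N, R i =
      (1 / (N : ℝ)) * (Rmin - Real.logb 2 (∏ i ∈ Finset.Icc 1 N, a i))
        + Real.logb 2 (a i) := by
    intro i hi
    have hai := hpos i hi
    have hE : 0 < ∏ j ∈ (Finset.Icc 1 N).erase i, a j :=
      Finset.prod_pos (fun j hj => hpos j (Finset.mem_of_mem_erase hj))
    rw [hR i hi, ← Finset.mul_prod_erase _ _ hi, Real.logb_div (pow_pos hai _).ne' hE.ne',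
      Real.logb_mul hai.ne' hE.ne', Real.logb_pow, Nat.cast_sub hN]
    field_simp
    push_cast
    ring
  have hc : ((2 : ℝ) ^ Rmin / ∏ i ∈ Finset.Icc 1 N, a i) ^ ((1 : ℝ) / (N : ℝ)) =
      (2 : ℝ) ^ ((1 / (N : ℝ)) * (Rmin - Real.logb 2 (∏ i ∈ Finset.Icc 1 N, a i))) := by
    rw [mul_comm, Real.rpow_mul (by norm_num), Real.rpow_sub (by norm_num),
      Real.rpow_logb (by norm_num) (by norm_num) hP]
  constructor
  · rw [Finset.sum_congr rfl key, Finset.sum_add_distrib, ← hlogP, Finset.sum_const,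
      Nat.card_Icc, nsmul_eq_mul, Nat.add_sub_cancel]
    field_simp
    ring
  · rw [hc]
    have h2 : ∀ i ∈ Finset.Icc 1 N, ((2 : ℝ) ^ (R i) - 1) / a i =
        (2 : ℝ) ^ ((1 / (N : ℝ)) * (Rmin - Real.logb 2 (∏ i ∈ Finset.Icc 1 N, a i)))
          - 1 / a i := by
      intro i hi
      have hai := hpos i hi
      rw [key i hi, Real.rpow_add (by norm_num),
        Real.rpow_logb (by norm_num) (by norm_num) hai, sub_div,
        mul_div_assoc, div_self hai.ne', mul_one]
    rw [Finset.sum_congr rfl h2, Finset.sum_sub_distrib, Finset.sum_const,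
      Nat.card_Icc, nsmul_eq_mul, Nat.add_sub_cancel]
end

section
/- Let N ≥ 2, let a1 ≥ a2 ≥ … ≥ aN > 0, and let R_min > 0 satisfy 2^{R_min} ≤ (a1·a2·…·a_{N−1}) / a_N^{N−1}. Then the minimum of ∑_{i=1}^N (2^{R_i} − 1)/a_i over all nonnegative vectors (R_1, …, R_N) with ∑_{i=1}^N R_i = R_min is attained at a vector with R_N = 0; equivalently, this minimum equals the minimum of ∑_{i=1}^{N−1} (2^{R_i} − 1)/a_i over nonnegative (R_1, …, R_{N−1}) with ∑_{i=1}^{N−1} R_i = R_min. -/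
/-- Theorem 1 (necessity part): if `2^Rmin ≤ (∏_{i<N} a i)/(a N)^(N−1)`, the
power minimum over the rate simplex is attained at a vector with `R N = 0`;
equivalently, the minimum over `N` links coincides with the minimum over the
best `N − 1` links. -/
theorem N_link_last_channel_useless
    (N : ℕ) (hN : 2 ≤ N) (a : ℕ → ℝ)
    (hpos : ∀ i ∈ Finset.Icc 1 N, 0 < a i)
    (hmono : ∀ i j : ℕ, 1 ≤ i → i ≤ j → j ≤ N → a j ≤ a i)
    (Rmin : ℝ) (hRmin : 0 < Rmin)
    (hcond : (2 : ℝ) ^ Rmin ≤ (∏ i ∈ Finset.Icc 1 (N - 1), a i) / (a N) ^ (N - 1)) :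
    (∃ R : ℕ → ℝ, (∀ i ∈ Finset.Icc 1 N, 0 ≤ R i) ∧
      (∑ i ∈ Finset.Icc 1 N, R i = Rmin) ∧ R N = 0 ∧
      ∀ S : ℕ → ℝ, (∀ i ∈ Finset.Icc 1 N, 0 ≤ S i) →
        (∑ i ∈ Finset.Icc 1 N, S i = Rmin) →
        ∑ i ∈ Finset.Icc 1 N, ((2 : ℝ) ^ (R i) - 1) / a i ≤
          ∑ i ∈ Finset.Icc 1 N, ((2 : ℝ) ^ (S i) - 1) / a i) ∧
    sInf {p : ℝ | ∃ R : ℕ → ℝ, (∀ i ∈ Finset.Icc 1 N, 0 ≤ R i) ∧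
        (∑ i ∈ Finset.Icc 1 N, R i = Rmin) ∧
        p = ∑ i ∈ Finset.Icc 1 N, ((2 : ℝ) ^ (R i) - 1) / a i} =
      sInf {p : ℝ | ∃ R : ℕ → ℝ, (∀ i ∈ Finset.Icc 1 (N - 1), 0 ≤ R i) ∧
        (∑ i ∈ Finset.Icc 1 (N - 1), R i = Rmin) ∧
        p = ∑ i ∈ Finset.Icc 1 (N - 1), ((2 : ℝ) ^ (R i) - 1) / a i} := by
  obtain ⟨n, rfl⟩ : ∃ n, N = n + 1 := ⟨N - 1, by omega⟩
  simp only [Nat.add_sub_cancel] at hcond ⊢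
  have hn : 1 ≤ n := by omega
  have hsub : ∀ i ∈ Finset.Icc 1 n, i ∈ Finset.Icc 1 (n + 1) := by
    intro i hi
    rw [Finset.mem_Icc] at hi ⊢
    omega
  have haN : 0 < a (n + 1) := hpos _ (by simp)
  have hl2 : 0 < Real.log 2 := Real.log_pos (by norm_num)
  set L : ℕ → ℝ := fun i => Real.logb 2 (a i) with hL
  have h2L : ∀ i ∈ Finset.Icc 1 (n + 1), (2 : ℝ) ^ (L i) = a i := fun i hi =>
    Real.rpow_logb (by norm_num) (by norm_num) (hpos i hi)
  have hLmono : ∀ i j : ℕ, 1 ≤ i → i ≤ j → j ≤ n + 1 → L j ≤ L i := by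
    intro i j h1 h2 h3
    exact Real.logb_le_logb_of_le (by norm_num)
      (hpos j (Finset.mem_Icc.2 ⟨by omega, h3⟩)) (hmono i j h1 h2 h3)
  have hge : Rmin ≤ ∑ i ∈ Finset.Icc 1 n, (L i - L (n + 1)) := by
    have h1 : (2 : ℝ) ^ Rmin ≤ (2 : ℝ) ^ (∑ i ∈ Finset.Icc 1 n, (L i - L (n + 1))) := by
      refine hcond.trans (le_of_eq ?_)
      rw [Real.rpow_sum_of_pos (by norm_num)]
      have : ∀ i ∈ Finset.Icc 1 n, (2 : ℝ) ^ (L i - L (n + 1)) = a i / a (n + 1) := by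
        intro i hi
        rw [Real.rpow_sub (by norm_num), h2L i (hsub i hi), h2L (n + 1) (by simp)]
      rw [Finset.prod_congr rfl this, Finset.prod_div_distrib]
      simp
    exact (Real.rpow_le_rpow_left_iff (by norm_num)).1 h1
  obtain ⟨t, ⟨ht1, ht2⟩, ht⟩ : ∃ t ∈ Set.Icc (-L 1) (-L (n + 1)),
      ∑ i ∈ Finset.Icc 1 n, max 0 (t + L i) = Rmin := by
    have hc : Continuous (fun t : ℝ => ∑ i ∈ Finset.Icc 1 n, max 0 (t + L i)) := by
      fun_prop
    have hle : -L 1 ≤ -L (n + 1) := neg_le_neg (hLmono 1 (n + 1) le_rfl (by omega) le_rfl)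
    refine intermediate_value_Icc hle hc.continuousOn ⟨?_, ?_⟩
    · refine le_trans (le_of_eq ?_) hRmin.le
      refine Finset.sum_eq_zero fun i hi => max_eq_left ?_
      rw [Finset.mem_Icc] at hi
      linarith [hLmono 1 i le_rfl hi.1 (by omega)]
    · refine hge.trans (Finset.sum_le_sum fun i hi => le_trans (le_of_eq (by ring)) (le_max_right _ _))
  set R : ℕ → ℝ := fun i => max 0 (t + L i) with hR
  have hR0 : ∀ i, 0 ≤ R i := fun i => le_max_left _ _
  have hRN : R (n + 1) = 0 := max_eq_left (by linarith)
  have hsum : ∑ i ∈ Finset.Icc 1 (n + 1), R i = Rmin := by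
    rw [Finset.sum_Icc_succ_top (by omega), hRN, add_zero]
    exact ht
  have hterm : ∀ i ∈ Finset.Icc 1 (n + 1), ∀ x : ℝ, 0 ≤ x →
      ((2 : ℝ) ^ (R i) - 1) / a i + Real.log 2 * (2 : ℝ) ^ t * (x - R i)
        ≤ ((2 : ℝ) ^ x - 1) / a i := by
    intro i hi x hx
    have hai := hpos i hi
    have htan : (2 : ℝ) ^ (R i) * (1 + (x - R i) * Real.log 2) ≤ (2 : ℝ) ^ x := by
      have e : (2 : ℝ) ^ x = (2 : ℝ) ^ (R i) * (2 : ℝ) ^ (x - R i) := by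
        rw [← Real.rpow_add (by norm_num)]
        congr 1
        ring
      rw [e, Real.rpow_def_of_pos (by norm_num) (x - R i)]
      refine mul_le_mul_of_nonneg_left ?_ (by positivity)
      have := Real.add_one_le_exp (Real.log 2 * (x - R i))
      linarith
    have hta : (2 : ℝ) ^ (t + L i) = (2 : ℝ) ^ t * a i := by
      rw [Real.rpow_add (by norm_num), h2L i hi]
    have hkey : (2 : ℝ) ^ t * a i * (x - R i) ≤ (2 : ℝ) ^ (R i) * (x - R i) := by
      rcases le_total 0 (t + L i) with h | h
      · have : R i = t + L i := max_eq_right h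
        rw [← hta, ← this]
      · have h0 : R i = 0 := max_eq_left h
        rw [h0, ← hta]
        refine mul_le_mul_of_nonneg_right ?_ (by linarith)
        exact Real.rpow_le_rpow_of_exponent_le (by norm_num) h
    rw [div_add' _ _ _ hai.ne']
    refine div_le_div_of_nonneg_right ?_ hai.le
    have := mul_le_mul_of_nonneg_left hkey hl2.le
    nlinarith
  have hopt : ∀ s : Finset ℕ, (∀ i ∈ s, i ∈ Finset.Icc 1 (n + 1)) → ∑ i ∈ s, R i = Rmin →
      ∀ S : ℕ → ℝ, (∀ i ∈ s, 0 ≤ S i) → ∑ i ∈ s, S i = Rmin →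
        ∑ i ∈ s, ((2 : ℝ) ^ (R i) - 1) / a i ≤ ∑ i ∈ s, ((2 : ℝ) ^ (S i) - 1) / a i := by
    intro s hs hRs S hS hSs
    have h := Finset.sum_le_sum fun i hi => hterm i (hs i hi) (S i) (hS i hi)
    rw [Finset.sum_add_distrib, ← Finset.mul_sum, Finset.sum_sub_distrib, hRs, hSs] at h
    simpa using h
  have hval : ∑ i ∈ Finset.Icc 1 (n + 1), ((2 : ℝ) ^ (R i) - 1) / a i
      = ∑ i ∈ Finset.Icc 1 n, ((2 : ℝ) ^ (R i) - 1) / a i := by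
    rw [Finset.sum_Icc_succ_top (by omega), hRN]
    simp
  refine ⟨⟨R, fun i _ => hR0 i, hsum, hRN, hopt _ (fun i hi => hi) hsum⟩, ?_⟩
  trans ∑ i ∈ Finset.Icc 1 (n + 1), ((2 : ℝ) ^ (R i) - 1) / a i
  · apply IsLeast.csInf_eq
    refine ⟨⟨R, fun i _ => hR0 i, hsum, rfl⟩, ?_⟩
    rintro _ ⟨S, h1, h2, rfl⟩
    exact hopt _ (fun i hi => hi) hsum S h1 h2
  · symm
    apply IsLeast.csInf_eq
    refine ⟨⟨R, fun i _ => hR0 i, ht, hval⟩, ?_⟩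
    rintro _ ⟨S, h1, h2, rfl⟩
    rw [hval]
    exact hopt _ hsub ht S h1 h2
end

section
/- Let N ≥ 1, let a1 ≥ a2 ≥ … ≥ aN > 0, and let R_min > 0. Then there exists a unique integer N* with 1 ≤ N* ≤ N such that (a1·a2·…·a_{N*−1}) / a_{N*}^{N*−1} < 2^{R_min}, and either N* = N or 2^{R_min} ≤ (a1·a2·…·a_{N*}) / a_{N*+1}^{N*}. Moreover, the minimum of ∑_{i=1}^N (2^{R_i} − 1)/a_i over all nonnegative vectors (R_1, …, R_N) with ∑_{i=1}^N R_i = R_min equals N*·(2^{R_min} / ∏_{i=1}^{N*} a_i)^{1/N*} − ∑_{i=1}^{N*} 1/a_i. -/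
lemma aux_icc_sum (n N : ℕ) (h : n ≤ N) (f : ℕ → ℝ) :
    ∑ i ∈ Finset.Icc 1 N, (if i ≤ n then f i else 0) = ∑ i ∈ Finset.Icc 1 n, f i := by
  rw [← Finset.sum_filter]
  apply Finset.sum_congr _ (fun _ _ => rfl)
  ext i
  simp only [Finset.mem_filter, Finset.mem_Icc]
  omega

lemma aux_min (N : ℕ) (a : ℕ → ℝ)
    (hpos : ∀ i ∈ Finset.Icc 1 N, 0 < a i) (Rmin : ℝ) (n : ℕ) (hn : n ≤ N) (μ : ℝ) (hμ : 0 < μ)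
    (hμn : μ ^ n * ∏ i ∈ Finset.Icc 1 n, a i = (2:ℝ) ^ Rmin)
    (h1 : ∀ i ∈ Finset.Icc 1 N, i ≤ n → 1 ≤ μ * a i)
    (h2 : ∀ i ∈ Finset.Icc 1 N, n < i → μ * a i ≤ 1) :
    IsLeast {p : ℝ | ∃ R : ℕ → ℝ, (∀ i ∈ Finset.Icc 1 N, 0 ≤ R i) ∧
          (∑ i ∈ Finset.Icc 1 N, R i = Rmin) ∧
          p = ∑ i ∈ Finset.Icc 1 N, ((2 : ℝ) ^ (R i) - 1) / a i}
        ((n : ℝ) * μ - ∑ i ∈ Finset.Icc 1 n, 1 / a i) := by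
  have hposn : ∀ i ∈ Finset.Icc 1 n, 0 < a i := fun i hi => hpos i (by
    simp only [Finset.mem_Icc] at hi ⊢; omega)
  have hL : 0 < Real.log 2 := Real.log_pos (by norm_num)
  set S : ℕ → ℝ := fun i => if i ≤ n then Real.log (μ * a i) / Real.log 2 else 0 with hS
  have hSsum : ∑ i ∈ Finset.Icc 1 N, S i = Rmin := by
    rw [hS, aux_icc_sum n N hn, ← Finset.sum_div, ← Real.log_prod
      (fun i hi => (mul_pos hμ (hposn i hi)).ne'), Finset.prod_mul_distrib, Finset.prod_const,
      Nat.card_Icc, Nat.add_sub_cancel, hμn, Real.log_rpow (by norm_num)]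
    field_simp
  have hval : ∑ i ∈ Finset.Icc 1 N, (if i ≤ n then μ - 1 / a i else 0)
      = (n : ℝ) * μ - ∑ i ∈ Finset.Icc 1 n, 1 / a i := by
    rw [aux_icc_sum n N hn, Finset.sum_sub_distrib]
    simp
  have hexp : ∀ x : ℝ, (2:ℝ) ^ x = Real.exp (Real.log 2 * x) := fun x =>
    Real.rpow_def_of_pos (by norm_num) x
  constructor
  · refine ⟨S, ?_, hSsum, ?_⟩
    · intro i hi
      simp only [hS]
      split_ifs with h
      · exact div_nonneg (Real.log_nonneg (h1 i hi h)) hL.le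
      · exact le_rfl
    · rw [← hval]
      apply Finset.sum_congr rfl
      intro i hi
      have ha := hpos i hi
      simp only [hS]
      split_ifs with h
      · rw [hexp, mul_div_cancel₀ _ hL.ne', Real.exp_log (mul_pos hμ ha)]
        field_simp
      · simp
  · rintro p ⟨R, hR0, hRs, rfl⟩
    have key : ∀ i ∈ Finset.Icc 1 N, (if i ≤ n then μ - 1 / a i else 0)
        + μ * Real.log 2 * (R i - S i) ≤ ((2 : ℝ) ^ (R i) - 1) / a i := by
      intro i hi
      have ha := hpos i hi
      rw [le_div_iff₀ ha, hexp]
      simp only [hS]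
      split_ifs with h
      · have e := Real.add_one_le_exp (Real.log 2 * R i - Real.log (μ * a i))
        rw [Real.exp_sub, Real.exp_log (mul_pos hμ ha), le_div_iff₀ (mul_pos hμ ha)] at e
        have : (μ - 1 / a i + μ * Real.log 2 * (R i - Real.log (μ * a i) / Real.log 2)) * a i
          = (Real.log 2 * R i - Real.log (μ * a i) + 1) * (μ * a i) - 1 := by
          field_simp
          ring
        linarith
      · have e := Real.add_one_le_exp (Real.log 2 * R i)
        have := mul_le_mul_of_nonneg_right (h2 i hi (by omega)) (mul_nonneg hL.le (hR0 i hi))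
        nlinarith
    have := Finset.sum_le_sum key
    rw [Finset.sum_add_distrib, hval, ← Finset.mul_sum, Finset.sum_sub_distrib, hRs, hSsum] at this
    linarith

lemma aux_step (N : ℕ) (a : ℕ → ℝ) (k : ℕ) (hk : 1 ≤ k) (hak : 0 < a k) :
    (∏ i ∈ Finset.Icc 1 (k - 1), a i) / (a k) ^ (k - 1)
      = (∏ i ∈ Finset.Icc 1 k, a i) / (a k) ^ k := by
  obtain ⟨m, rfl⟩ : ∃ m, k = m + 1 := ⟨k - 1, by omega⟩
  rw [Nat.add_sub_cancel, Finset.prod_Icc_succ_top (by omega), pow_succ]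
  field_simp

/-- Corollary 1: there is a unique `N* ∈ {1, …, N}` with
`(∏_{i<N*} a i)/(a N*)^(N*−1) < 2^Rmin` and (`N* = N` or
`2^Rmin ≤ (∏_{i≤N*} a i)/(a (N*+1))^(N*)`); moreover the minimum transmit power
over the rate simplex equals `N*·(2^Rmin/∏_{i≤N*} a i)^(1/N*) − ∑_{i≤N*} 1/a i`. -/
theorem optimal_number_of_links
    (N : ℕ) (hN : 1 ≤ N) (a : ℕ → ℝ)
    (hpos : ∀ i ∈ Finset.Icc 1 N, 0 < a i)
    (hmono : ∀ i j : ℕ, 1 ≤ i → i ≤ j → j ≤ N → a j ≤ a i)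
    (Rmin : ℝ) (hRmin : 0 < Rmin) :
    ∃ Nstar : ℕ,
      (1 ≤ Nstar ∧ Nstar ≤ N ∧
        (∏ i ∈ Finset.Icc 1 (Nstar - 1), a i) / (a Nstar) ^ (Nstar - 1) < (2 : ℝ) ^ Rmin ∧
        (Nstar = N ∨
          (2 : ℝ) ^ Rmin ≤ (∏ i ∈ Finset.Icc 1 Nstar, a i) / (a (Nstar + 1)) ^ Nstar)) ∧
      (∀ M : ℕ, 1 ≤ M → M ≤ N →
        (∏ i ∈ Finset.Icc 1 (M - 1), a i) / (a M) ^ (M - 1) < (2 : ℝ) ^ Rmin →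
        (M = N ∨ (2 : ℝ) ^ Rmin ≤ (∏ i ∈ Finset.Icc 1 M, a i) / (a (M + 1)) ^ M) →
        M = Nstar) ∧
      IsLeast {p : ℝ | ∃ R : ℕ → ℝ, (∀ i ∈ Finset.Icc 1 N, 0 ≤ R i) ∧
          (∑ i ∈ Finset.Icc 1 N, R i = Rmin) ∧
          p = ∑ i ∈ Finset.Icc 1 N, ((2 : ℝ) ^ (R i) - 1) / a i}
        ((Nstar : ℝ) * ((2 : ℝ) ^ Rmin / ∏ i ∈ Finset.Icc 1 Nstar, a i) ^ ((1 : ℝ) / (Nstar : ℝ)) -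
          ∑ i ∈ Finset.Icc 1 Nstar, 1 / a i) := by
  set f : ℕ → ℝ := fun k => (∏ i ∈ Finset.Icc 1 (k - 1), a i) / (a k) ^ (k - 1) with hf
  have hp : ∀ i, 1 ≤ i → i ≤ N → 0 < a i := fun i h1 h2 => hpos i (Finset.mem_Icc.2 ⟨h1, h2⟩)
  have hP : ∀ k, k ≤ N → 0 < ∏ i ∈ Finset.Icc 1 k, a i := fun k hk =>
    Finset.prod_pos (fun i hi => hp i (Finset.mem_Icc.1 hi).1 ((Finset.mem_Icc.1 hi).2.trans hk))
  have hstep : ∀ k, 1 ≤ k → k + 1 ≤ N → f k ≤ f (k + 1) := by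
    intro k hk hkN
    simp only [hf, Nat.add_sub_cancel]
    rw [aux_step N a k hk (hp k hk (by omega))]
    have h0 := hp (k + 1) (by omega) hkN
    have h3 := hmono k (k + 1) hk (by omega) hkN
    exact div_le_div_of_nonneg_left (hP k (by omega)).le (pow_pos h0 k)
      (pow_le_pow_left₀ h0.le h3 k)
  have hfm : ∀ j k, 1 ≤ j → j ≤ k → k ≤ N → f j ≤ f k := by
    intro j k hj hjk
    induction k, hjk using Nat.le_induction with
    | base => intro _; exact le_rfl
    | succ k hk ih => intro hkN; exact (ih (by omega)).trans (hstep k (by omega) hkN)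
  have hone : f 1 < (2:ℝ) ^ Rmin := by
    simp only [hf]
    simpa using Real.one_lt_rpow (by norm_num : (1:ℝ) < 2) hRmin
  classical
  set n := Nat.findGreatest (fun k => f k < (2:ℝ) ^ Rmin) N with hn
  have hn1 : 1 ≤ n := Nat.le_findGreatest hN hone
  have hnN : n ≤ N := Nat.findGreatest_le N
  have hfn : f n < (2:ℝ) ^ Rmin :=
    Nat.findGreatest_spec (P := fun k => f k < (2:ℝ) ^ Rmin) hN hone
  have hfn' : n = N ∨ (2:ℝ) ^ Rmin ≤ f (n + 1) := by
    rcases hnN.eq_or_lt with h | h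
    · exact Or.inl h
    · exact Or.inr (not_lt.1 (Nat.findGreatest_is_greatest
        (P := fun k => f k < (2:ℝ) ^ Rmin) (Nat.lt_succ_self n) h))
  refine ⟨n, ⟨hn1, hnN, hfn, hfn'⟩, ?_, ?_⟩
  · intro M hM1 hMN hlt hor
    have hle : M ≤ n := Nat.le_findGreatest hMN hlt
    rcases hor with h | h
    · omega
    · by_contra hne
      have h4 : f (M + 1) ≤ f n := hfm _ _ (by omega) (by omega) hnN
      have h5 : (2:ℝ) ^ Rmin ≤ f (M + 1) := h
      linarith
  · have h2R : 0 < (2:ℝ) ^ Rmin := Real.rpow_pos_of_pos (by norm_num) _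
    have hq : 0 < (2:ℝ) ^ Rmin / ∏ i ∈ Finset.Icc 1 n, a i := div_pos h2R (hP n hnN)
    set μ := ((2:ℝ) ^ Rmin / ∏ i ∈ Finset.Icc 1 n, a i) ^ ((1:ℝ) / (n:ℝ)) with hμd
    have hμ : 0 < μ := Real.rpow_pos_of_pos hq _
    have hμq : μ ^ n = (2:ℝ) ^ Rmin / ∏ i ∈ Finset.Icc 1 n, a i := by
      rw [hμd, one_div, Real.rpow_inv_natCast_pow hq.le (by omega)]
    have hμn : μ ^ n * ∏ i ∈ Finset.Icc 1 n, a i = (2:ℝ) ^ Rmin := by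
      rw [hμq, div_mul_cancel₀ _ (hP n hnN).ne']
    apply aux_min N a hpos Rmin n hnN μ hμ hμn
    · intro i hi hin
      have hi1 := (Finset.mem_Icc.1 hi).1
      have han := hp n hn1 hnN
      have hb : 1 ≤ μ * a n := by
        simp only [hf] at hfn
        rw [aux_step N a n hn1 han, div_lt_iff₀ (pow_pos han n), ← hμn] at hfn
        have h6 : 1 < (μ * a n) ^ n := by
          rw [mul_pow]
          by_contra hc
          have := mul_le_mul_of_nonneg_right (not_lt.1 hc) (hP n hnN).le
          nlinarith
        by_contra hc
        have := pow_le_one₀ (n := n) (mul_pos hμ han).le (not_le.1 hc).le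
        linarith
      exact hb.trans (mul_le_mul_of_nonneg_left (hmono i n hi1 hin hnN) hμ.le)
    · intro i hi hin
      have hiN := (Finset.mem_Icc.1 hi).2
      have han := hp (n + 1) (by omega) (by omega)
      have hb : μ * a (n + 1) ≤ 1 := by
        rcases hfn' with h | h
        · omega
        simp only [hf, Nat.add_sub_cancel] at h
        rw [le_div_iff₀ (pow_pos han n), ← hμn] at h
        have h6 : (μ * a (n + 1)) ^ n ≤ 1 := by
          rw [mul_pow]
          by_contra hc
          have := mul_lt_mul_of_pos_right (not_le.1 hc) (hP n hnN)
          nlinarith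
        by_contra hc
        have := one_lt_pow₀ (not_le.1 hc) (show n ≠ 0 by omega)
        linarith
      exact (mul_le_mul_of_nonneg_left (hmono (n + 1) i (by omega) hin hiN) hμ.le).trans hb
end

section
/- Let N ≥ 1, let a1, …, aN > 0, and let 0 < R < R' be real numbers. Then the infimum of ∑_{i=1}^N (2^{R_i} − 1)/a_i over nonnegative vectors with ∑_{i=1}^N R_i = R' is strictly greater than the infimum of the same objective over nonnegative vectors with ∑_{i=1}^N R_i = R. In particular, any coded transmission scheme with coding rate R_C < 1 (which must meet the latency constraint with rate sum R_min/R_C instead of R_min) requires strictly more transmit power than the optimal uncoded scheme for the same latency constraint. -/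
theorem two_rpow_gap (x y : ℝ) (hx : 0 ≤ x) (hxy : x ≤ y) :
    (y - x) * Real.log 2 ≤ (2 : ℝ) ^ y - (2 : ℝ) ^ x := by
  have h1 : (1 : ℝ) ≤ (2 : ℝ) ^ x := Real.one_le_rpow (by norm_num) hx
  have h2 : (y - x) * Real.log 2 + 1 ≤ (2 : ℝ) ^ (y - x) := by
    rw [Real.rpow_def_of_pos (by norm_num), mul_comm]
    exact Real.add_one_le_exp _
  have h3 : (2 : ℝ) ^ y = (2 : ℝ) ^ x * (2 : ℝ) ^ (y - x) := by
    rw [← Real.rpow_add (by norm_num)]; congr 1; ring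
  have h4 : 0 ≤ (y - x) * Real.log 2 :=
    mul_nonneg (by linarith) (Real.log_nonneg (by norm_num))
  rw [h3]
  nlinarith

/-- Lemma 6 (coding costs power): the minimum transmit power is strictly
increasing in the required total spectral efficiency: for `0 < R < R'`, the
infimum of the total power over nonnegative rate vectors summing to `R'` is
strictly greater than the infimum over rate vectors summing to `R`. -/
theorem min_power_strictly_increasing_in_rate
    (N : ℕ) (hN : 1 ≤ N) (a : ℕ → ℝ)
    (hpos : ∀ i ∈ Finset.Icc 1 N, 0 < a i)
    (R R' : ℝ) (hR : 0 < R) (hRR' : R < R') :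
    sInf {p : ℝ | ∃ v : ℕ → ℝ, (∀ i ∈ Finset.Icc 1 N, 0 ≤ v i) ∧
        (∑ i ∈ Finset.Icc 1 N, v i = R) ∧
        p = ∑ i ∈ Finset.Icc 1 N, ((2 : ℝ) ^ (v i) - 1) / a i} <
      sInf {p : ℝ | ∃ v : ℕ → ℝ, (∀ i ∈ Finset.Icc 1 N, 0 ≤ v i) ∧
        (∑ i ∈ Finset.Icc 1 N, v i = R') ∧
        p = ∑ i ∈ Finset.Icc 1 N, ((2 : ℝ) ^ (v i) - 1) / a i} := by
  have hR' : 0 < R' := hR.trans hRR'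
  have hA : 0 < ∑ i ∈ Finset.Icc 1 N, a i :=
    Finset.sum_pos hpos ⟨1, Finset.mem_Icc.2 ⟨le_rfl, hN⟩⟩
  have hl : 0 < Real.log 2 := Real.log_pos (by norm_num)
  set A := ∑ i ∈ Finset.Icc 1 N, a i with hAdef
  have ht0 : 0 < R / R' := div_pos hR hR'
  have ht1 : R / R' < 1 := (div_lt_one hR').2 hRR'
  have htR : R / R' * R' = R := div_mul_cancel₀ _ hR'.ne'
  set t := R / R' with ht
  have hd : 0 < (1 - t) * Real.log 2 / A * R' := by
    have : 0 < 1 - t := by linarith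
    positivity
  refine lt_of_lt_of_le (lt_add_of_pos_right _ hd) (le_csInf ?_ ?_)
  · refine ⟨_, fun i => if i = 1 then R' else 0, ?_, ?_, rfl⟩
    · intro i _
      dsimp only
      split_ifs <;> linarith
    · rw [Finset.sum_ite_eq' (Finset.Icc 1 N) 1 (fun _ => R')]
      simp [hN]
  · rintro p ⟨v, hv, hs, rfl⟩
    have hle : ∑ i ∈ Finset.Icc 1 N, ((2 : ℝ) ^ (t * v i) - 1) / a i
        + (1 - t) * Real.log 2 / A * R' ≤
        ∑ i ∈ Finset.Icc 1 N, ((2 : ℝ) ^ (v i) - 1) / a i := by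
      rw [← hs, Finset.mul_sum, ← Finset.sum_add_distrib]
      refine Finset.sum_le_sum fun i hi => ?_
      have hai := hpos i hi
      have haA : a i ≤ A := Finset.single_le_sum (fun j hj => (hpos j hj).le) hi
      have hvi := hv i hi
      have hg := two_rpow_gap (t * v i) (v i) (mul_nonneg ht0.le hvi) (by nlinarith)
      have h0 : 0 ≤ (1 - t) * Real.log 2 * v i :=
        mul_nonneg (mul_nonneg (by linarith) hl.le) hvi
      have h1 : (1 - t) * Real.log 2 / A * v i ≤ ((2 : ℝ) ^ (v i) - (2 : ℝ) ^ (t * v i)) / a i := by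
        calc (1 - t) * Real.log 2 / A * v i = (1 - t) * Real.log 2 * v i / A := by ring
          _ ≤ (1 - t) * Real.log 2 * v i / a i := div_le_div_of_nonneg_left h0 hai haA
          _ ≤ _ := by
            apply div_le_div_of_nonneg_right _ hai.le
            linarith
      calc _ ≤ ((2 : ℝ) ^ (t * v i) - 1) / a i
            + ((2 : ℝ) ^ (v i) - (2 : ℝ) ^ (t * v i)) / a i := by linarith
        _ = _ := by ring
    refine le_trans (add_le_add_left (csInf_le ?_ ?_) _) hle
    · refine ⟨0, ?_⟩
      rintro p ⟨w, hw, _, rfl⟩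
      refine Finset.sum_nonneg fun i hi => div_nonneg ?_ (hpos i hi).le
      have := Real.one_le_rpow (x := 2) (by norm_num) (hw i hi)
      linarith
    · exact ⟨fun i => t * v i, fun i hi => mul_nonneg ht0.le (hv i hi),
        by rw [← Finset.mul_sum, hs, htR], rfl⟩
end

section
/- Let N ≥ 3, let A > 1, and let 0 < d_1 ≤ d_2 ≤ … ≤ d_N be real numbers. If d_N^{N−1} < A·d_1·d_2·…·d_{N−1}, then d_{N−1}^{N−2} < A·d_1·d_2·…·d_{N−2}. Consequently the events E_N = {d_N^{N−1} < A·d_1·…·d_{N−1}} are nested: E_N implies E_{N−1}, and iterating, E_N implies E_k for every 2 ≤ k ≤ N. -/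
/-- Equation (32) (nested events): for ordered distances
`0 < d 1 ≤ d 2 ≤ ⋯ ≤ d N` and `A > 1`, if `(d N)^(N−1) < A·∏_{i<N} d i`, then
`(d (N−1))^(N−2) < A·∏_{i<N−1} d i`; iterating, the same holds at every level
`2 ≤ k ≤ N`. -/
theorem nested_multilink_events
    (N : ℕ) (hN : 3 ≤ N) (A : ℝ) (hA : 1 < A) (d : ℕ → ℝ)
    (hpos : ∀ i ∈ Finset.Icc 1 N, 0 < d i)
    (hmono : ∀ i j : ℕ, 1 ≤ i → i ≤ j → j ≤ N → d i ≤ d j)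
    (hEN : (d N) ^ (N - 1) < A * ∏ i ∈ Finset.Icc 1 (N - 1), d i) :
    (d (N - 1)) ^ (N - 2) < A * ∏ i ∈ Finset.Icc 1 (N - 2), d i ∧
    ∀ k : ℕ, 2 ≤ k → k ≤ N →
      (d k) ^ (k - 1) < A * ∏ i ∈ Finset.Icc 1 (k - 1), d i := by
  have step : ∀ m : ℕ, m + 2 ≤ N →
      (d (m + 2)) ^ (m + 1) < A * ∏ i ∈ Finset.Icc 1 (m + 1), d i →
      (d (m + 1)) ^ m < A * ∏ i ∈ Finset.Icc 1 m, d i := by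
    intro m hm h
    have hp : 0 < d (m + 1) := hpos _ (Finset.mem_Icc.mpr ⟨by omega, by omega⟩)
    have hle : d (m + 1) ≤ d (m + 2) := hmono _ _ (by omega) (by omega) hm
    have h1 : d (m + 1) ^ (m + 1) ≤ d (m + 2) ^ (m + 1) := pow_le_pow_left₀ hp.le hle _
    rw [Finset.prod_Icc_succ_top (by omega), ← mul_assoc] at h
    rw [pow_succ] at h1
    exact lt_of_mul_lt_mul_right (lt_of_le_of_lt h1 h) hp.le
  have all : ∀ j m : ℕ, m + 1 + j = N →
      (d (m + 1)) ^ m < A * ∏ i ∈ Finset.Icc 1 m, d i := by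
    intro j
    induction j with
    | zero =>
      intro m hm
      subst hm
      simpa using hEN
    | succ j ih =>
      intro m hm
      exact step m (by omega) (ih (m + 1) (by omega))
  have fin : ∀ k : ℕ, 2 ≤ k → k ≤ N →
      (d k) ^ (k - 1) < A * ∏ i ∈ Finset.Icc 1 (k - 1), d i := by
    intro k hk hkN
    obtain ⟨m, rfl⟩ : ∃ m, k = m + 1 := ⟨k - 1, by omega⟩
    simpa using all (N - (m + 1)) m (by omega)
  refine ⟨?_, fin⟩
  have h := fin (N - 1) (by omega) (by omega)
  rwa [show N - 1 - 1 = N - 2 by omega] at h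
end

section
/- Let λ > 0 and A > 1. Then the triple integral ∫_0^∞ ∫_{x_1}^{x_1 A} ∫_{x_2}^{√(x_1 x_2 A)} (2λπ)^3 · x_1 · x_2 · x_3 · e^{−λπ x_3^2} dx_3 dx_2 dx_1 = 1 − (1 + 2·ln A)/A^2, where ln denotes the natural logarithm. In particular this value does not depend on λ. -/
open Real MeasureTheory

lemma inner3 (c u v : ℝ) (hc : 0 < c) : ∫ x in u..v, x * exp (-(c * x^2)) = (exp (-(c*u^2)) - exp (-(c*v^2)))/(2*c) := by
  rw [intervalIntegral.integral_eq_sub_of_hasDerivAt (f := fun x => - exp (-(c*x^2))/(2*c))]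
  · ring
  · intro x _
    have h : HasDerivAt (fun x : ℝ => -(c*x^2)) (-(c*(2*x))) x := by
      refine HasDerivAt.congr_deriv ((hasDerivAt_pow 2 x).const_mul c).neg ?_
      norm_num
    refine HasDerivAt.congr_deriv (h.exp.neg.div_const (2*c)) ?_
    field_simp
  · apply Continuous.intervalIntegrable; fun_prop

lemma cube (b : ℝ) (hb : 0 < b) : ∫ x in Set.Ioi (0:ℝ), x^3 * exp (-(b * x^2)) = 1/(2*b^2) := by
  have := integral_rpow_mul_exp_neg_mul_rpow (p := 2) (q := 3) (b := b) (by norm_num) (by norm_num) hb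
  have e : ((3:ℝ)+1)/2 = 2 := by norm_num
  have e' : -((3:ℝ)+1)/2 = -2 := by norm_num
  rw [e, e', Gamma_two, rpow_neg hb.le] at this
  norm_cast at this
  simp only [neg_mul] at this
  rw [this]; field_simp

lemma cube_int (b : ℝ) (hb : 0 < b) : IntegrableOn (fun x : ℝ => x^3 * exp (-(b * x^2))) (Set.Ioi 0) := by
  have := integrableOn_rpow_mul_exp_neg_mul_sq hb (s := 3) (by norm_num)
  norm_cast at this
  simpa only [neg_mul] using this

lemma outer (A : ℝ) (hA : 1 < A) : ∫ s in (1:ℝ)..A, 2 * s * (1/s^4 - 1/(s*A)^2) = 1 - (1 + 2 * log A)/A^2 := by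
  have hp : ∀ x ∈ Set.uIcc 1 A, 0 < x := by
    intro x hx; rw [Set.uIcc_of_le hA.le] at hx; linarith [hx.1]
  rw [intervalIntegral.integral_eq_sub_of_hasDerivAt (f := fun s => -(s^2)⁻¹ - 2 / A^2 * log s)]
  · simp; field_simp; ring
  · intro x hx
    have := hp x hx
    refine HasDerivAt.congr_deriv (((hasDerivAt_pow 2 x).inv (by positivity)).neg.sub ((hasDerivAt_log this.ne').const_mul (2/A^2))) ?_
    norm_num
    field_simp
  · apply ContinuousOn.intervalIntegrable
    intro x hx
    have := hp x hx
    apply ContinuousAt.continuousWithinAt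
    have h4 : x^4 ≠ 0 := by positivity
    have h5 : (x*A)^2 ≠ 0 := by positivity
    fun_prop (disch := assumption)

/-- Proof of Lemma 3, triple integral: `P{d₃² < d₁·d₂·A} = 1 − (1 + 2·ln A)/A²`,
independently of the Poisson intensity `l`. -/
theorem poisson_three_link_probability (l A : ℝ) (hl : 0 < l) (hA : 1 < A) :
    ∫ x1 in Set.Ioi (0 : ℝ),
      (∫ x2 in x1..(x1 * A),
        (∫ x3 in x2..(Real.sqrt (x1 * x2 * A)),
          (2 * l * π) ^ 3 * x1 * x2 * x3 * Real.exp (-(l * π * x3 ^ 2)))) =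
      1 - (1 + 2 * Real.log A) / A ^ 2 := by
  obtain ⟨c, hc⟩ : ∃ c, c = l * π := ⟨_, rfl⟩
  have hc0 : 0 < c := by rw [hc]; positivity
  have hA0 : 0 < A := by linarith
  have step1 : ∀ x1 ∈ Set.Ioi (0:ℝ), (∫ x2 in x1..(x1 * A),
        (∫ x3 in x2..(Real.sqrt (x1 * x2 * A)),
          (2 * l * π) ^ 3 * x1 * x2 * x3 * Real.exp (-(l * π * x3 ^ 2)))) =
      ∫ s in Set.Ioc 1 A, 4 * c^2 * s * (x1^3 * exp (-(c * s^2 * x1^2)) - x1^3 * exp (-(c * (s * A) * x1^2))) := by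
    intro x hx
    have hx : 0 < x := hx
    rw [← intervalIntegral.integral_of_le hA.le]
    have := intervalIntegral.mul_integral_comp_mul_left (a := 1) (b := A) (c := x) (f := fun x2 => (∫ x3 in x2..(Real.sqrt (x * x2 * A)),
          (2 * l * π) ^ 3 * x * x2 * x3 * Real.exp (-(l * π * x3 ^ 2))))
    rw [mul_one] at this
    rw [← this, ← intervalIntegral.integral_const_mul]
    apply intervalIntegral.integral_congr
    intro s hs
    rw [Set.uIcc_of_le hA.le] at hs
    have hs0 : 0 < s := by linarith [hs.1]
    simp only [mul_assoc (_ : ℝ) (_ : ℝ) (exp _), ← hc]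
    simp only [← mul_assoc]
    simp only [mul_assoc _ _ (exp _)]
    rw [intervalIntegral.integral_const_mul, inner3 c _ _ hc0, sq_sqrt (by positivity),
      mul_assoc 2 l, ← hc, show c * (x*s)^2 = c * s^2 * x^2 by ring,
      show c * (x * x * s * A) = c * s * A * x^2 by ring]
    field_simp
    ring
  rw [setIntegral_congr_fun measurableSet_Ioi step1, integral_integral_swap, ← outer A hA,
    intervalIntegral.integral_of_le hA.le]
  · apply setIntegral_congr_fun measurableSet_Ioc
    intro s hs
    have hs0 : 0 < s := by linarith [hs.1]
    simp only
    rw [integral_const_mul, integral_sub (cube_int _ (by positivity)) (cube_int _ (by positivity)),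
      cube _ (by positivity), cube _ (by positivity)]
    field_simp
    norm_num
  · have hb : Integrable (fun z : ℝ × ℝ => (z.1^3 * exp (-(c * z.1^2))) * (4 * c^2 * A))
        ((volume.restrict (Set.Ioi 0)).prod (volume.restrict (Set.Ioc 1 A))) :=
      (cube_int c hc0).mul_prod (integrable_const _)
    refine hb.mono' (by apply Continuous.aestronglyMeasurable; fun_prop) ?_
    rw [Measure.prod_restrict]
    refine (ae_restrict_iff' (measurableSet_Ioi.prod measurableSet_Ioc)).2 (.of_forall ?_)
    rintro ⟨x, s⟩ ⟨hx, hs1, hs2⟩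
    simp only [Set.mem_Ioi] at hx hs1 hs2
    have hs0 : 0 < s := by linarith
    simp only [Function.uncurry]
    rw [← mul_sub, norm_mul, norm_of_nonneg (by positivity : 0 ≤ 4 * c^2 * s), norm_mul, norm_of_nonneg (by positivity : 0 ≤ x^3)]
    have h1 : exp (-(c * s^2 * x^2)) ≤ exp (-(c * x^2)) := by
      apply exp_le_exp.2
      have : 1 ≤ s^2 := by nlinarith
      nlinarith [mul_nonneg (by positivity : 0 ≤ c * x^2) (sub_nonneg.2 this)]
    have h2 : exp (-(c * (s * A) * x^2)) ≤ exp (-(c * x^2)) := by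
      apply exp_le_exp.2
      have : 1 ≤ s * A := by nlinarith
      nlinarith [mul_nonneg (by positivity : 0 ≤ c * x^2) (sub_nonneg.2 this)]
    have h3 : ‖exp (-(c * s^2 * x^2)) - exp (-(c * (s * A) * x^2))‖ ≤ exp (-(c * x^2)) := by
      rw [norm_eq_abs, abs_le]
      constructor <;> linarith [exp_pos (-(c * s^2 * x^2)), exp_pos (-(c * (s * A) * x^2))]
    calc _ ≤ 4 * c^2 * A * (x^3 * exp (-(c * x^2))) := by gcongr
      _ = _ := by ring
end

section
/- Singleton bound for asymmetric block codes: Let N ≥ 1 and let n_1 ≥ n_2 ≥ … ≥ n_N ≥ 1 be block lengths with n_c = ∑_{i=1}^N n_i. Let C be a set of codewords, each codeword being a tuple (x_1, …, x_N) with x_i a binary vector of length n_i, and suppose |C| ≥ 2. Let k = log2|C| and let ℓ ∈ {1, …, N} be the unique integer with ∑_{i=ℓ+1}^N n_i < k ≤ ∑_{i=ℓ}^N n_i. Let M = (1/(N−ℓ+1))·∑_{i=ℓ}^N n_i. Define the block-diversity δ of C as the minimum over distinct codewords x ≠ y in C of the number of indices i ∈ {1, …, N} with x_i ≠ y_i.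 Then δ ≤ ℓ and δ ≤ ⌊1 + N − k/M⌋. -/
/-- Theorem 2 (Singleton bound for the asymmetric block-erasure channel):
codewords are tuples of `N` binary blocks of nonincreasing lengths
`n 0 ≥ n 1 ≥ ⋯ ≥ n (N−1) ≥ 1` (block `i` of the paper's 1-based indexing is
index `i − 1` here). With `k = log2|C|`, `ℓ ∈ {1, …, N}` the unique integer such
that `∑_{i=ℓ+1}^N n_i < k ≤ ∑_{i=ℓ}^N n_i` and
`M = (∑_{i=ℓ}^N n_i)/(N − ℓ + 1)`, the block-diversity `δ` of `C` satisfies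
`δ ≤ ℓ` and `δ ≤ ⌊1 + N − k/M⌋`. -/
theorem singleton_bound_asymmetric_block_codes
    (N : ℕ) (hN : 1 ≤ N) (n : Fin N → ℕ)
    (hn : ∀ i, 1 ≤ n i)
    (hmono : ∀ i j : Fin N, i ≤ j → n j ≤ n i)
    (C : Finset ((i : Fin N) → Fin (n i) → Bool)) (hC : 2 ≤ C.card)
    (k : ℝ) (hk : k = Real.logb 2 (C.card : ℝ))
    (ℓ : ℕ) (hℓ1 : 1 ≤ ℓ) (hℓ2 : ℓ ≤ N)
    (hℓ3 : ((∑ i ∈ Finset.univ.filter (fun i : Fin N => ℓ ≤ i.val), n i : ℕ) : ℝ) < k)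
    (hℓ4 : k ≤ ((∑ i ∈ Finset.univ.filter (fun i : Fin N => ℓ ≤ i.val + 1), n i : ℕ) : ℝ))
    (M : ℝ)
    (hM : M = (1 / ((N : ℝ) - (ℓ : ℝ) + 1)) *
      ((∑ i ∈ Finset.univ.filter (fun i : Fin N => ℓ ≤ i.val + 1), n i : ℕ) : ℝ))
    (δ : ℕ)
    (hδ : IsLeast {d : ℕ | ∃ x ∈ C, ∃ y ∈ C, x ≠ y ∧
      d = {i : Fin N | x i ≠ y i}.ncard} δ) :
    δ ≤ ℓ ∧ (δ : ℤ) ≤ ⌊(1 : ℝ) + (N : ℝ) - k / M⌋ := by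
  have hS0 : (0 : ℝ) ≤ ((∑ i ∈ Finset.univ.filter (fun i : Fin N => ℓ ≤ i.val), n i : ℕ) : ℝ) :=
    Nat.cast_nonneg _
  have hk0 : 0 < k := lt_of_le_of_lt hS0 hℓ3
  have h1 : δ ≤ ℓ := by
    have hcard : 2 ^ (∑ i ∈ Finset.univ.filter (fun i : Fin N => ℓ ≤ i.val), n i) < C.card := by
      rw [hk, Real.lt_logb_iff_rpow_lt (by norm_num) (by positivity), Real.rpow_natCast] at hℓ3
      exact_mod_cast hℓ3
    have hT : (Finset.univ : Finset ((i : {i : Fin N // ℓ ≤ i.val}) → Fin (n i.1) → Bool)).card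
        < C.card := by
      refine lt_of_le_of_lt (le_of_eq ?_) hcard
      rw [Finset.card_univ, Fintype.card_pi]
      simp only [Fintype.card_pi, Fintype.card_bool, Finset.prod_const, Finset.card_univ,
        Fintype.card_fin]
      rw [Finset.prod_pow_eq_pow_sum]
      congr 1
      exact (Finset.sum_subtype (Finset.univ.filter (fun i : Fin N => ℓ ≤ i.val))
        (by simp) n).symm
    obtain ⟨x, hx, y, hy, hxy, he⟩ := Finset.exists_ne_map_eq_of_card_lt_of_maps_to hT
      (f := fun x i => x i.1) (fun _ _ => Finset.mem_coe.2 (Finset.mem_univ _))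
    have hle := hδ.2 ⟨x, hx, y, hy, hxy, rfl⟩
    refine hle.trans ?_
    have hsub : (Fin.val '' {i : Fin N | x i ≠ y i}) ⊆ (Finset.range ℓ : Set ℕ) := by
      rintro _ ⟨i, hi, rfl⟩
      by_contra hc
      apply hi
      have hc' : ℓ ≤ i.val := by simpa using hc
      exact congrFun he ⟨i, hc'⟩
    have h2 := Set.ncard_le_ncard hsub (Finset.finite_toSet _)
    rw [Set.ncard_image_of_injective _ Fin.val_injective, Set.ncard_coe_finset,
      Finset.card_range] at h2
    exact h2
  refine ⟨h1, ?_⟩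
  rw [Int.le_floor]
  have h1' : (δ : ℝ) ≤ ℓ := by exact_mod_cast h1
  have h2' : (ℓ : ℝ) ≤ N := by exact_mod_cast hℓ2
  have hD : 0 < (N : ℝ) - ℓ + 1 := by linarith
  have hSpos := lt_of_lt_of_le hk0 hℓ4
  have hMpos : 0 < M := by rw [hM]; positivity
  have hq : k / M ≤ (N : ℝ) - ℓ + 1 := by
    rw [div_le_iff₀ hMpos, hM, ← mul_assoc, mul_one_div_cancel hD.ne', one_mul]
    exact hℓ4
  push_cast
  linarith
end

section
/- Let N ≥ 1 and let n_1 ≥ n_2 ≥ … ≥ n_N ≥ 1 be block lengths. Let C be a set of codewords with block structure (n_1, …, n_N), |C| ≥ 2, k = log2|C|, and let ℓ ∈ {1, …, N} be the unique integer with ∑_{i=ℓ+1}^N n_i < k ≤ ∑_{i=ℓ}^N n_i; set M = (1/(N−ℓ+1))·∑_{i=ℓ}^N n_i. If k > M, then the block-diversity δ of C satisfies δ < N; that is, C cannot have full diversity. -/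
/-- Corollary 2: with the notation of the Singleton bound (blocks 0-indexed over
`Fin N`, `k = log2|C|`, `ℓ` the unique integer with
`∑_{i=ℓ+1}^N n_i < k ≤ ∑_{i=ℓ}^N n_i`, `M` the average length of the last
`N − ℓ + 1` blocks), if `k > M` then the block-diversity `δ` satisfies `δ < N`:
the code cannot have full diversity. -/
theorem no_full_diversity_of_high_rate
    (N : ℕ) (hN : 1 ≤ N) (n : Fin N → ℕ)
    (hn : ∀ i, 1 ≤ n i)
    (hmono : ∀ i j : Fin N, i ≤ j → n j ≤ n i)
    (C : Finset ((i : Fin N) → Fin (n i) → Bool)) (hC : 2 ≤ C.card)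
    (k : ℝ) (hk : k = Real.logb 2 (C.card : ℝ))
    (ℓ : ℕ) (hℓ1 : 1 ≤ ℓ) (hℓ2 : ℓ ≤ N)
    (hℓ3 : ((∑ i ∈ Finset.univ.filter (fun i : Fin N => ℓ ≤ i.val), n i : ℕ) : ℝ) < k)
    (hℓ4 : k ≤ ((∑ i ∈ Finset.univ.filter (fun i : Fin N => ℓ ≤ i.val + 1), n i : ℕ) : ℝ))
    (M : ℝ)
    (hM : M = (1 / ((N : ℝ) - (ℓ : ℝ) + 1)) *
      ((∑ i ∈ Finset.univ.filter (fun i : Fin N => ℓ ≤ i.val + 1), n i : ℕ) : ℝ))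
    (hkM : M < k)
    (δ : ℕ)
    (hδ : IsLeast {d : ℕ | ∃ x ∈ C, ∃ y ∈ C, x ≠ y ∧
      d = {i : Fin N | x i ≠ y i}.ncard} δ) :
    δ < N := by
  by_contra hlt
  push Not at hlt
  have hall : ∀ x ∈ C, ∀ y ∈ C, x ≠ y → ∀ i, x i ≠ y i := by
    intro x hx y hy hxy i hi
    have h1 : δ ≤ {i : Fin N | x i ≠ y i}.ncard := hδ.2 ⟨x, hx, y, hy, hxy, rfl⟩
    have h2 : {i : Fin N | x i ≠ y i}.ncard < (Set.univ : Set (Fin N)).ncard := by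
      apply Set.ncard_lt_ncard _ Set.finite_univ
      rw [Set.ssubset_univ_iff]
      intro h
      have : i ∈ {i : Fin N | x i ≠ y i} := by rw [h]; trivial
      exact this hi
    rw [Set.ncard_univ, Nat.card_eq_fintype_card, Fintype.card_fin] at h2
    omega
  let t : Fin N := ⟨N - 1, by omega⟩
  have hcard : C.card ≤ 2 ^ n t := by
    have := Finset.card_le_card_of_injOn (s := C)
      (t := (Finset.univ : Finset (Fin (n t) → Bool))) (fun x => x t)
      (fun x _ => by simp) (by
        intro x hx y hy h
        by_contra hne
        exact hall x hx y hy hne t h)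
    simpa using this
  have hkt : k ≤ n t := by
    rw [hk, Real.logb_le_iff_le_rpow (by norm_num) (by exact_mod_cast (by omega : 0 < C.card)),
      Real.rpow_natCast]
    exact_mod_cast hcard
  have hfc : (Finset.univ.filter (fun i : Fin N => ℓ ≤ i.val + 1)).card = N - ℓ + 1 := by
    have h : Finset.univ.filter (fun i : Fin N => ℓ ≤ i.val + 1)
        = Finset.Ici (⟨ℓ - 1, by omega⟩ : Fin N) := by
      ext i
      simp [Fin.le_def]
    rw [h, Fin.card_Ici]
    simp only
    omega
  have hsum : (N - ℓ + 1) * n t ≤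
      ∑ i ∈ Finset.univ.filter (fun i : Fin N => ℓ ≤ i.val + 1), n i := by
    rw [← hfc, ← smul_eq_mul]
    apply Finset.card_nsmul_le_sum
    intro i _
    apply hmono
    rw [Fin.le_def]
    have := i.2
    simp only [t]
    omega
  have hsum' : ((N : ℝ) - ℓ + 1) * n t ≤
      ((∑ i ∈ Finset.univ.filter (fun i : Fin N => ℓ ≤ i.val + 1), n i : ℕ) : ℝ) := by
    have h : (((N - ℓ + 1) * n t : ℕ) : ℝ) ≤ _ := Nat.cast_le.mpr hsum
    rw [Nat.cast_mul, Nat.cast_add, Nat.cast_sub hℓ2, Nat.cast_one] at h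
    exact h
  have hpos : (0 : ℝ) < (N : ℝ) - ℓ + 1 := by
    have : (ℓ : ℝ) ≤ N := by exact_mod_cast hℓ2
    linarith
  have : (n t : ℝ) ≤ M := by
    rw [hM, one_div, inv_mul_eq_div, le_div_iff₀ hpos]
    linarith
  linarith
end

section
/- Outage probability lower bound: Let N ≥ 1, let n_1 ≥ n_2 ≥ … ≥ n_N ≥ 1 be natural numbers, let 0 ≤ P_1 ≤ P_2 ≤ … ≤ P_N ≤ 1 be real erasure probabilities, and let k be a real threshold with 0 < k ≤ ∑_{i=1}^N n_i. Define P_out = ∑_{S ⊆ {1,…,N}, ∑_{i∈S} n_i < k} (∏_{i∈S} (1 − P_i)) · (∏_{i∉S} P_i). Let j ∈ {0, …, N−1} be the unique integer with ∑_{i=1}^j n_i < k ≤ ∑_{i=1}^{j+1} n_i. Then P_out ≥ ∑_{u=0}^{j} ( binom(N, u) · ∏_{i=1}^{N−u} P_i · ∏_{i=N−u+1}^{N} (1 − P_i) ). -/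
theorem aux_low (N : ℕ) (f : ℕ → ℝ) (h0 : ∀ i ∈ Finset.Icc 1 N, 0 ≤ f i)
    (hm : ∀ i j : ℕ, 1 ≤ i → i ≤ j → j ≤ N → f i ≤ f j) (m : ℕ) :
    ∀ S : Finset ℕ, S ⊆ Finset.Icc 1 N → S.card = m →
      ∏ i ∈ Finset.Icc 1 m, f i ≤ ∏ i ∈ S, f i := by
  induction m with
  | zero => intro S _ hc; rw [Finset.card_eq_zero] at hc; simp [hc]
  | succ m ih =>
    intro S hS hc
    have hne : S.Nonempty := Finset.card_pos.mp (by omega)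
    set M := S.max' hne with hM
    have hMS : M ∈ S := S.max'_mem hne
    have hMN := Finset.mem_Icc.mp (hS hMS)
    have hsub : S ⊆ Finset.Icc 1 M := fun x hx =>
      Finset.mem_Icc.mpr ⟨(Finset.mem_Icc.mp (hS hx)).1, S.le_max' x hx⟩
    have hle := Finset.card_le_card hsub
    rw [Nat.card_Icc] at hle
    rw [← Finset.prod_erase_mul S f hMS, Finset.prod_Icc_succ_top (by omega)]
    have hE : S.erase M ⊆ Finset.Icc 1 N := (Finset.erase_subset _ _).trans hS
    apply mul_le_mul
    · exact ih _ hE (by rw [Finset.card_erase_of_mem hMS]; omega)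
    · exact hm _ _ (by omega) (by omega) hMN.2
    · exact h0 _ (Finset.mem_Icc.mpr ⟨by omega, by omega⟩)
    · exact Finset.prod_nonneg fun i hi => h0 i (hE hi)

theorem aux_sum (N : ℕ) (f : ℕ → ℕ)
    (hm : ∀ i j : ℕ, 1 ≤ i → i ≤ j → j ≤ N → f j ≤ f i) (m : ℕ) :
    ∀ S : Finset ℕ, S ⊆ Finset.Icc 1 N → S.card = m →
      ∑ i ∈ S, f i ≤ ∑ i ∈ Finset.Icc 1 m, f i := by
  induction m with
  | zero => intro S _ hc; rw [Finset.card_eq_zero] at hc; simp [hc]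
  | succ m ih =>
    intro S hS hc
    have hne : S.Nonempty := Finset.card_pos.mp (by omega)
    set M := S.max' hne with hM
    have hMS : M ∈ S := S.max'_mem hne
    have hMN := Finset.mem_Icc.mp (hS hMS)
    have hsub : S ⊆ Finset.Icc 1 M := fun x hx =>
      Finset.mem_Icc.mpr ⟨(Finset.mem_Icc.mp (hS hx)).1, S.le_max' x hx⟩
    have hle := Finset.card_le_card hsub
    rw [Nat.card_Icc] at hle
    rw [← Finset.sum_erase_add S f hMS, Finset.sum_Icc_succ_top (by omega)]
    have hE : S.erase M ⊆ Finset.Icc 1 N := (Finset.erase_subset _ _).trans hS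
    apply add_le_add
    · exact ih _ hE (by rw [Finset.card_erase_of_mem hMS]; omega)
    · exact hm _ _ (by omega) (by omega) hMN.2

theorem aux_high (N : ℕ) (f : ℕ → ℝ) (h0 : ∀ i ∈ Finset.Icc 1 N, 0 ≤ f i)
    (hm : ∀ i j : ℕ, 1 ≤ i → i ≤ j → j ≤ N → f j ≤ f i) (m : ℕ) :
    ∀ S : Finset ℕ, S ⊆ Finset.Icc 1 N → S.card = m →
      ∏ i ∈ Finset.Icc (N - m + 1) N, f i ≤ ∏ i ∈ S, f i := by
  induction m with
  | zero => intro S _ hc; rw [Finset.card_eq_zero] at hc; simp [hc]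
  | succ m ih =>
    intro S hS hc
    have hne : S.Nonempty := Finset.card_pos.mp (by omega)
    set M := S.min' hne with hM
    have hMS : M ∈ S := S.min'_mem hne
    have hMN := Finset.mem_Icc.mp (hS hMS)
    have hsub : S ⊆ Finset.Icc M N := fun x hx =>
      Finset.mem_Icc.mpr ⟨S.min'_le x hx, (Finset.mem_Icc.mp (hS hx)).2⟩
    have hle := Finset.card_le_card hsub
    rw [Nat.card_Icc] at hle
    have hI : Finset.Icc (N - (m + 1) + 1) N = insert (N - m) (Finset.Icc (N - m + 1) N) := by
      ext x; simp only [Finset.mem_Icc, Finset.mem_insert]; omega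
    rw [hI, Finset.prod_insert (by simp), ← Finset.mul_prod_erase S f hMS]
    have hE : S.erase M ⊆ Finset.Icc 1 N := (Finset.erase_subset _ _).trans hS
    apply mul_le_mul
    · exact hm _ _ hMN.1 (by omega) (by omega)
    · exact ih _ hE (by rw [Finset.card_erase_of_mem hMS]; omega)
    · refine Finset.prod_nonneg fun i hi => h0 i ?_
      rw [Finset.mem_Icc] at hi ⊢; omega
    · exact h0 _ (hS hMS)

/-- Theorem 3 (outage probability, lower bound): blocks `1, …, N` have
nonincreasing lengths `n 1 ≥ ⋯ ≥ n N ≥ 1` and nondecreasing erasure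
probabilities `P 1 ≤ ⋯ ≤ P N` in `[0,1]`. With
`P_out = ∑_{S : ∑_{i∈S} n_i < k} ∏_{i∈S}(1 − P_i)·∏_{i∉S} P_i` and `j` the
unique integer with `∑_{i=1}^j n_i < k ≤ ∑_{i=1}^{j+1} n_i`, one has
`P_out ≥ ∑_{u=0}^{j} C(N,u)·∏_{i=1}^{N−u} P_i·∏_{i=N−u+1}^{N} (1 − P_i)`. -/
theorem outage_probability_lower_bound
    (N : ℕ) (hN : 1 ≤ N) (n : ℕ → ℕ) (P : ℕ → ℝ)
    (hn : ∀ i ∈ Finset.Icc 1 N, 1 ≤ n i)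
    (hnmono : ∀ i j : ℕ, 1 ≤ i → i ≤ j → j ≤ N → n j ≤ n i)
    (hP0 : ∀ i ∈ Finset.Icc 1 N, 0 ≤ P i)
    (hP1 : ∀ i ∈ Finset.Icc 1 N, P i ≤ 1)
    (hPmono : ∀ i j : ℕ, 1 ≤ i → i ≤ j → j ≤ N → P i ≤ P j)
    (k : ℝ) (hk0 : 0 < k)
    (hkN : k ≤ ((∑ i ∈ Finset.Icc 1 N, n i : ℕ) : ℝ))
    (j : ℕ) (hj : j + 1 ≤ N)
    (hj1 : ((∑ i ∈ Finset.Icc 1 j, n i : ℕ) : ℝ) < k)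
    (hj2 : k ≤ ((∑ i ∈ Finset.Icc 1 (j + 1), n i : ℕ) : ℝ)) :
    ∑ u ∈ Finset.range (j + 1),
        (N.choose u : ℝ) * (∏ i ∈ Finset.Icc 1 (N - u), P i) *
          ∏ i ∈ Finset.Icc (N - u + 1) N, (1 - P i) ≤
      ∑ S ∈ (Finset.Icc 1 N).powerset.filter
          (fun S => ((∑ i ∈ S, n i : ℕ) : ℝ) < k),
        (∏ i ∈ S, (1 - P i)) * ∏ i ∈ Finset.Icc 1 N \ S, P i := by
  have hQ0 : ∀ i ∈ Finset.Icc 1 N, 0 ≤ 1 - P i := fun i hi => by linarith [hP1 i hi]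
  have hw : ∀ S ⊆ Finset.Icc 1 N,
      0 ≤ (∏ i ∈ S, (1 - P i)) * ∏ i ∈ Finset.Icc 1 N \ S, P i := fun S hS =>
    mul_nonneg (Finset.prod_nonneg fun i hi => hQ0 i (hS hi))
      (Finset.prod_nonneg fun i hi => hP0 i (Finset.sdiff_subset hi))
  calc _ ≤ ∑ u ∈ Finset.range (j + 1), ∑ S ∈ (Finset.Icc 1 N).powersetCard u,
        (∏ i ∈ S, (1 - P i)) * ∏ i ∈ Finset.Icc 1 N \ S, P i := by
        refine Finset.sum_le_sum fun u hu => ?_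
        have hcard : ((Finset.Icc 1 N).powersetCard u).card = N.choose u := by simp
        rw [mul_assoc, ← hcard, ← nsmul_eq_mul]
        refine Finset.card_nsmul_le_sum _ _ _ fun S hS => ?_
        obtain ⟨hS, hc⟩ := Finset.mem_powersetCard.mp hS
        rw [mul_comm]
        apply mul_le_mul
        · exact aux_high N (fun i => 1 - P i) hQ0
            (fun a b h1 h2 h3 => by linarith [hPmono a b h1 h2 h3]) u S hS hc
        · refine aux_low N P hP0 hPmono (N - u) _ Finset.sdiff_subset ?_
          rw [Finset.card_sdiff_of_subset hS, hc]; simp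
        · refine Finset.prod_nonneg fun i hi => hP0 i ?_
          rw [Finset.mem_Icc] at hi ⊢; omega
        · exact Finset.prod_nonneg fun i hi => hQ0 i (hS hi)
    _ = ∑ S ∈ (Finset.Icc 1 N).powerset.filter (fun S => S.card ∈ Finset.range (j + 1)),
        (∏ i ∈ S, (1 - P i)) * ∏ i ∈ Finset.Icc 1 N \ S, P i := by
        rw [← Finset.sum_fiberwise_of_maps_to (t := Finset.range (j + 1)) (g := Finset.card)
          (fun S hS => (Finset.mem_filter.mp hS).2)]
        refine Finset.sum_congr rfl fun u hu => Finset.sum_congr ?_ fun _ _ => rfl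
        ext S
        simp only [Finset.mem_powersetCard, Finset.mem_filter, Finset.mem_powerset]
        constructor
        · rintro ⟨h1, rfl⟩; exact ⟨⟨h1, hu⟩, rfl⟩
        · rintro ⟨⟨h1, _⟩, h2⟩; exact ⟨h1, h2⟩
    _ ≤ _ := by
        refine Finset.sum_le_sum_of_subset_of_nonneg ?_ fun S hS _ =>
          hw S (Finset.mem_powerset.mp (Finset.mem_filter.mp hS).1)
        intro S hS
        simp only [Finset.mem_filter, Finset.mem_powerset, Finset.mem_range] at hS ⊢
        refine ⟨hS.1, lt_of_le_of_lt ?_ hj1⟩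
        refine Nat.cast_le.mpr ((aux_sum N n hnmono _ S hS.1 rfl).trans ?_)
        exact Finset.sum_le_sum_of_subset (Finset.Icc_subset_Icc le_rfl (by omega))
end

section
/- Outage probability upper bound: Let N ≥ 1, let n_1 ≥ n_2 ≥ … ≥ n_N ≥ 1 be natural numbers, let 0 ≤ P_1 ≤ P_2 ≤ … ≤ P_N ≤ 1 be real erasure probabilities, and let k be a real threshold with 0 < k ≤ ∑_{i=1}^N n_i. Define P_out = ∑_{S ⊆ {1,…,N}, ∑_{i∈S} n_i < k} (∏_{i∈S} (1 − P_i)) · (∏_{i∉S} P_i). Let ℓ ∈ {1, …, N} be the unique integer with ∑_{i=ℓ+1}^N n_i < k ≤ ∑_{i=ℓ}^N n_i. Then P_out ≤ ∑_{u=0}^{N−ℓ} ( binom(N, u) · ∏_{i=1}^{u} (1 − P_i) · ∏_{i=u+1}^{N} P_i ). -/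
theorem exch_prod (S A : Finset ℕ) (f : ℕ → ℝ) (c : ℝ) (hc : 0 ≤ c) (hcard : S.card = A.card)
    (h0 : ∀ i ∈ S, 0 ≤ f i) (h1 : ∀ i ∈ S \ A, f i ≤ c) (h2 : ∀ i ∈ A \ S, c ≤ f i) :
    ∏ i ∈ S, f i ≤ ∏ i ∈ A, f i := by
  have e : (S \ A).card = (A \ S).card := Finset.card_sdiff_comm hcard
  have hS : ∏ i ∈ S \ A, f i ≤ c ^ (S \ A).card := by
    rw [← Finset.prod_const]
    exact Finset.prod_le_prod (fun i hi => h0 i (Finset.mem_sdiff.1 hi).1) h1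
  have hA : c ^ (A \ S).card ≤ ∏ i ∈ A \ S, f i := by
    rw [← Finset.prod_const]
    exact Finset.prod_le_prod (fun i hi => hc) h2
  rw [← Finset.prod_inter_mul_prod_sdiff S A f, ← Finset.prod_inter_mul_prod_sdiff A S f,
    Finset.inter_comm A S]
  apply mul_le_mul_of_nonneg_left
  · rw [e] at hS
    exact hS.trans hA
  · exact Finset.prod_nonneg fun i hi => h0 i (Finset.mem_inter.1 hi).1

theorem exch_sum (S A : Finset ℕ) (f : ℕ → ℕ) (c : ℕ) (hcard : A.card ≤ S.card)
    (h1 : ∀ i ∈ S \ A, c ≤ f i) (h2 : ∀ i ∈ A \ S, f i ≤ c) :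
    ∑ i ∈ A, f i ≤ ∑ i ∈ S, f i := by
  have e : (A \ S).card ≤ (S \ A).card := Finset.card_sdiff_le_card_sdiff_iff.2 hcard
  have hS := Finset.card_nsmul_le_sum _ _ _ h1
  have hA := Finset.sum_le_card_nsmul _ _ _ h2
  rw [← Finset.sum_inter_add_sum_sdiff S A f, ← Finset.sum_inter_add_sum_sdiff A S f,
    Finset.inter_comm A S]
  simp only [smul_eq_mul] at hS hA
  have := Nat.mul_le_mul_right c e
  exact Nat.add_le_add_left (hA.trans (this.trans hS)) _

/-- Theorem 3 (outage probability, upper bound): blocks `1, …, N` have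
nonincreasing lengths `n 1 ≥ ⋯ ≥ n N ≥ 1` and nondecreasing erasure
probabilities `P 1 ≤ ⋯ ≤ P N` in `[0,1]`. With
`P_out = ∑_{S : ∑_{i∈S} n_i < k} ∏_{i∈S}(1 − P_i)·∏_{i∉S} P_i` and `ℓ` the
unique integer with `∑_{i=ℓ+1}^N n_i < k ≤ ∑_{i=ℓ}^N n_i`, one has
`P_out ≤ ∑_{u=0}^{N−ℓ} C(N,u)·∏_{i=1}^{u} (1 − P_i)·∏_{i=u+1}^{N} P_i`. -/
theorem outage_probability_upper_bound
    (N : ℕ) (hN : 1 ≤ N) (n : ℕ → ℕ) (P : ℕ → ℝ)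
    (hn : ∀ i ∈ Finset.Icc 1 N, 1 ≤ n i)
    (hnmono : ∀ i j : ℕ, 1 ≤ i → i ≤ j → j ≤ N → n j ≤ n i)
    (hP0 : ∀ i ∈ Finset.Icc 1 N, 0 ≤ P i)
    (hP1 : ∀ i ∈ Finset.Icc 1 N, P i ≤ 1)
    (hPmono : ∀ i j : ℕ, 1 ≤ i → i ≤ j → j ≤ N → P i ≤ P j)
    (k : ℝ) (hk0 : 0 < k)
    (hkN : k ≤ ((∑ i ∈ Finset.Icc 1 N, n i : ℕ) : ℝ))
    (ℓ : ℕ) (hℓ1 : 1 ≤ ℓ) (hℓ2 : ℓ ≤ N)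
    (hℓ3 : ((∑ i ∈ Finset.Icc (ℓ + 1) N, n i : ℕ) : ℝ) < k)
    (hℓ4 : k ≤ ((∑ i ∈ Finset.Icc ℓ N, n i : ℕ) : ℝ)) :
    ∑ S ∈ (Finset.Icc 1 N).powerset.filter
        (fun S => ((∑ i ∈ S, n i : ℕ) : ℝ) < k),
      (∏ i ∈ S, (1 - P i)) * ∏ i ∈ Finset.Icc 1 N \ S, P i ≤
      ∑ u ∈ Finset.range (N - ℓ + 1),
        (N.choose u : ℝ) * (∏ i ∈ Finset.Icc 1 u, (1 - P i)) *
          ∏ i ∈ Finset.Icc (u + 1) N, P i := by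
  classical
  have hcardN : (Finset.Icc 1 N).card = N := by simp
  have key : ∀ S ∈ (Finset.Icc 1 N).powerset,
      (∏ i ∈ S, (1 - P i)) * ∏ i ∈ Finset.Icc 1 N \ S, P i ≤
      (∏ i ∈ Finset.Icc 1 S.card, (1 - P i)) * ∏ i ∈ Finset.Icc (S.card + 1) N, P i := by
    intro S hS
    rw [Finset.mem_powerset] at hS
    have hSN : S.card ≤ N := by simpa using Finset.card_le_card hS
    have hSm : ∀ i ∈ S, 1 ≤ i ∧ i ≤ N := fun i hi => Finset.mem_Icc.1 (hS hi)
    have hcc : (Finset.Icc 1 N \ S).card = N - S.card := by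
      rw [Finset.card_sdiff_of_subset hS, hcardN]
    apply mul_le_mul
    · rcases Nat.eq_zero_or_pos S.card with h | h
      · rw [Finset.card_eq_zero] at h
        simp [h]
      · apply exch_prod S _ _ (1 - P S.card)
        · linarith [hP1 S.card (Finset.mem_Icc.2 ⟨h, hSN⟩)]
        · simp
        · intro i hi
          linarith [hP1 i (hS hi)]
        · intro i hi
          simp only [Finset.mem_sdiff, Finset.mem_Icc] at hi
          have := hSm i hi.1
          linarith [hPmono S.card i h (by omega) this.2]
        · intro i hi
          simp only [Finset.mem_sdiff, Finset.mem_Icc] at hi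
          linarith [hPmono i S.card hi.1.1 hi.1.2 hSN]
    · rcases Nat.eq_or_lt_of_le hSN with h | h
      · have : Finset.Icc 1 N \ S = ∅ := by
          rw [← Finset.card_eq_zero]; omega
        rw [this, h]; simp
      · apply exch_prod _ _ _ (P (S.card + 1))
        · exact hP0 _ (Finset.mem_Icc.2 ⟨by omega, h⟩)
        · rw [hcc]; simp
        · intro i hi
          exact hP0 i (Finset.mem_sdiff.1 hi).1
        · intro i hi
          simp only [Finset.mem_sdiff, Finset.mem_Icc] at hi
          exact hPmono _ _ hi.1.1.1 (by omega) h
        · intro i hi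
          simp only [Finset.mem_sdiff, Finset.mem_Icc] at hi
          exact hPmono _ _ (by omega) hi.1.1 hi.1.2
    · exact Finset.prod_nonneg fun i hi => hP0 i (Finset.mem_sdiff.1 hi).1
    · refine Finset.prod_nonneg fun i hi => ?_
      rw [Finset.mem_Icc] at hi
      linarith [hP1 i (Finset.mem_Icc.2 ⟨hi.1, hi.2.trans hSN⟩)]
  have hmaps : ∀ S ∈ (Finset.Icc 1 N).powerset.filter
      (fun S => ((∑ i ∈ S, n i : ℕ) : ℝ) < k), S.card ∈ Finset.range (N - ℓ + 1) := by
    intro S hS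
    rw [Finset.mem_filter, Finset.mem_powerset] at hS
    obtain ⟨hS, hlt⟩ := hS
    rw [Finset.mem_range]
    by_contra hcon
    have : ∑ i ∈ Finset.Icc ℓ N, n i ≤ ∑ i ∈ S, n i := by
      apply exch_sum _ _ _ (n ℓ)
      · simp only [Nat.card_Icc]; omega
      · intro i hi
        rw [Finset.mem_sdiff, Finset.mem_Icc] at hi
        have := Finset.mem_Icc.1 (hS hi.1)
        exact hnmono _ _ this.1 (by omega) hℓ2
      · intro i hi
        rw [Finset.mem_sdiff, Finset.mem_Icc] at hi
        exact hnmono _ _ hℓ1 hi.1.1 hi.1.2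
    have h' : ((∑ i ∈ Finset.Icc ℓ N, n i : ℕ) : ℝ) ≤ ((∑ i ∈ S, n i : ℕ) : ℝ) :=
      Nat.cast_le.2 this
    linarith
  rw [← Finset.sum_fiberwise_of_maps_to hmaps]
  refine Finset.sum_le_sum fun u hu => ?_
  rw [Finset.mem_range] at hu
  set B : ℝ := (∏ i ∈ Finset.Icc 1 u, (1 - P i)) * ∏ i ∈ Finset.Icc (u + 1) N, P i with hB
  have hB0 : 0 ≤ B := by
    apply mul_nonneg <;> refine Finset.prod_nonneg fun i hi => ?_ <;> rw [Finset.mem_Icc] at hi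
    · linarith [hP1 i (Finset.mem_Icc.2 ⟨hi.1, by omega⟩)]
    · exact hP0 i (Finset.mem_Icc.2 ⟨by omega, hi.2⟩)
  rw [mul_assoc, ← hB]
  refine (Finset.sum_le_card_nsmul _ _ B ?_).trans ?_
  · intro S hS
    simp only [Finset.mem_filter] at hS
    have := key S hS.1.1
    rwa [hS.2] at this
  · rw [nsmul_eq_mul]
    apply mul_le_mul_of_nonneg_right _ hB0
    rw [Nat.cast_le]
    calc _ ≤ ((Finset.Icc 1 N).powersetCard u).card := by
          apply Finset.card_le_card
          intro S hS
          simp only [Finset.mem_filter, Finset.mem_powerset] at hS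
          exact Finset.mem_powersetCard.2 ⟨hS.1.1, hS.2⟩
      _ = N.choose u := by rw [Finset.card_powersetCard, hcardN]
end

section
/- Closed-form Lagrange multiplier for the two-link blocking problem: Let a_1, a_2 > 0, let R_min be real, and let 0 ≤ P_1, P_2 < 1 be blocking probabilities. Define γ = (ln 2) · 2^{(R_min − (1−P_1)·log2(a_1) − (1−P_2)·log2(a_2)) / (2 − P_1 − P_2)} and set p_i = γ/(ln 2) − 1/a_i for i = 1, 2. Then (1−P_1)·P_2·log2(1 + a_1 p_1) + P_1·(1−P_2)·log2(1 + a_2 p_2) + (1−P_1)·(1−P_2)·(log2(1 + a_1 p_1) + log2(1 + a_2 p_2)) = R_min; that is, the powers p_i = γ/(ln 2) − 1/a_i meet the average-rate constraint R̄ = R_min with equality. -/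
/-- Equations (38)–(40): with the closed-form Lagrange multiplier
`γ = ln 2 · 2^{(Rmin − (1−P₁)log2 a₁ − (1−P₂)log2 a₂)/(2 − P₁ − P₂)}` and powers
`pᵢ = γ/ln 2 − 1/aᵢ`, the average-rate constraint of the two-link blocking
problem is met with equality: `R̄ = Rmin`. -/
theorem two_link_blocking_multiplier_meets_rate
    (a1 a2 Rmin P1 P2 : ℝ) (ha1 : 0 < a1) (ha2 : 0 < a2)
    (hP1 : 0 ≤ P1) (hP1' : P1 < 1) (hP2 : 0 ≤ P2) (hP2' : P2 < 1)
    (γ p1 p2 : ℝ)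
    (hγ : γ = Real.log 2 *
      (2 : ℝ) ^ ((Rmin - (1 - P1) * Real.logb 2 a1 - (1 - P2) * Real.logb 2 a2) /
        (2 - P1 - P2)))
    (hp1 : p1 = γ / Real.log 2 - 1 / a1)
    (hp2 : p2 = γ / Real.log 2 - 1 / a2) :
    (1 - P1) * P2 * Real.logb 2 (1 + a1 * p1) +
      P1 * (1 - P2) * Real.logb 2 (1 + a2 * p2) +
      (1 - P1) * (1 - P2) *
        (Real.logb 2 (1 + a1 * p1) + Real.logb 2 (1 + a2 * p2)) = Rmin := by
  have hl : Real.log 2 ≠ 0 := (Real.log_pos one_lt_two).ne'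
  have hd : 2 - P1 - P2 ≠ 0 := by linarith
  obtain ⟨E, hE⟩ : ∃ E, E = (Rmin - (1 - P1) * Real.logb 2 a1 - (1 - P2) * Real.logb 2 a2) /
        (2 - P1 - P2) := ⟨_, rfl⟩
  rw [← hE] at hγ
  have hg : γ / Real.log 2 = (2 : ℝ) ^ E := by rw [hγ, mul_div_cancel_left₀ _ hl]
  have key : ∀ a : ℝ, 0 < a →
      Real.logb 2 (1 + a * ((2 : ℝ) ^ E - 1 / a)) = Real.logb 2 a + E := by
    intro a ha
    have h1 : 1 + a * ((2 : ℝ) ^ E - 1 / a) = a * (2 : ℝ) ^ E := by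
      field_simp
      ring
    rw [h1, Real.logb_mul ha.ne' (by positivity), Real.logb_rpow (by norm_num) (by norm_num)]
  rw [hp1, hp2, hg, key a1 ha1, key a2 ha2]
  have h2 := (eq_div_iff hd).mp hE
  linear_combination h2
end
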